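/- arXiv:2512.20596 — 8 statements merged into one kernel-verified Lean document; each statement's English description precedes it below -/
import Mathlib

section
/- Let Γ_r act on ℤ so that a acts by the shift n ↦ n+1 and b₁, …, b_{r−1} act by zebra permutations of one common type Z, and set R = max{R(b_j) : 1 ≤ j ≤ r−1}. If w ∈ Γ_r satisfies 3·R·‖w‖ < s(Z) (in particular R < ∞), then the number of orbits of the cyclic subgroup ⟨w⟩ acting on ℤ that are infinite is exactly |c_a(w)|. -/
open Set

/-- A zebra strip decomposition of `ℤ`, encoded by the endpoints of the black stripes:
`B k = [bl k, br k]` and `W k = [br k + 1, bl (k+1) - 1]`.  All stripes are nonempty finite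
intervals, arranged consecutively `…, W (k-1), B k, W k, B (k+1), …`, and they cover `ℤ`. -/
structure ZebraDecomp where
  bl : ℤ → ℤ
  br : ℤ → ℤ
  black_nonempty : ∀ k, bl k ≤ br k
  white_nonempty : ∀ k, br k + 1 ≤ bl (k + 1) - 1
  covers : ∀ n : ℤ, ∃ k, bl k ≤ n ∧ n < bl (k + 1)

/-- The `k`-th black stripe. -/
def ZebraDecomp.B (Z : ZebraDecomp) (k : ℤ) : Set ℤ := Icc (Z.bl k) (Z.br k)

/-- The `k`-th white stripe. -/
def ZebraDecomp.W (Z : ZebraDecomp) (k : ℤ) : Set ℤ := Icc (Z.br k + 1) (Z.bl (k + 1) - 1)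

/-- A permutation of `ℤ` is a zebra permutation of type `Z` if it preserves every white
stripe and fixes every black stripe pointwise. -/
def IsZebraPerm (Z : ZebraDecomp) (g : Equiv.Perm ℤ) : Prop :=
  (∀ k, g '' Z.W k = Z.W k) ∧ ∀ k, ∀ n ∈ Z.B k, g n = n

/-- The `a`-counting homomorphism `c_a : Γ_{r+1} → ℤ` on the free group with basis
`(a, b₁, …, b_r)` (the generator `a` corresponding to the index `0`), sending `a ↦ 1`
and `b_i ↦ 0`. -/
def aCount (r : ℕ) : FreeGroup (Fin (r + 1)) →* Multiplicative ℤ :=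
  FreeGroup.lift fun i => Multiplicative.ofAdd (if i = 0 then (1 : ℤ) else 0)

/-- The orbit of `x` under the cyclic group generated by `f`. -/
def zpowOrbit (f : Equiv.Perm ℤ) (x : ℤ) : Set ℤ := Set.range fun n : ℤ => (f ^ n) x

theorem zpowOrbit_inv (f : Equiv.Perm ℤ) (x : ℤ) : zpowOrbit f⁻¹ x = zpowOrbit f x := by
  ext y
  constructor
  · rintro ⟨n, rfl⟩
    exact ⟨-n, by simp⟩
  · rintro ⟨n, rfl⟩
    exact ⟨-n, by simp⟩

theorem zpowOrbit_zpow_apply (f : Equiv.Perm ℤ) (m x : ℤ) :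
    zpowOrbit f ((f ^ m) x) = zpowOrbit f x := by
  ext y
  constructor
  · rintro ⟨n, rfl⟩
    exact ⟨n + m, by simp [zpow_add]⟩
  · rintro ⟨n, rfl⟩
    exact ⟨n - m, by simp [zpow_sub]⟩

theorem zpow_sub_apply_eq_self {f : Equiv.Perm ℤ} {x m n : ℤ} (h : (f ^ m) x = (f ^ n) x) :
    (f ^ (m - n)) x = x := by
  rw [sub_eq_neg_add, zpow_add, Equiv.Perm.mul_apply, h, zpow_neg, Equiv.Perm.inv_eq_iff_eq]

theorem zpowOrbit_finite_of_zpow_eq {f : Equiv.Perm ℤ} {x m n : ℤ} (hmn : m ≠ n)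
    (h : (f ^ m) x = (f ^ n) x) : (zpowOrbit f x).Finite := by
  have hd : (f ^ (m - n)) x = x := zpow_sub_apply_eq_self h
  have hd0 : m - n ≠ 0 := sub_ne_zero.mpr hmn
  refine ((Set.finite_Ico (0 : ℤ) |m - n|).image fun k : ℤ => (f ^ k) x).subset ?_
  rintro _ ⟨k, rfl⟩
  refine ⟨k % (m - n), ⟨Int.emod_nonneg _ hd0, Int.emod_lt_abs _ hd0⟩, ?_⟩
  have hq : (f ^ ((m - n) * (k / (m - n)))) x = x := by
    rw [zpow_mul]
    exact Equiv.Perm.zpow_apply_eq_self_of_apply_eq_self hd _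
  change (f ^ (k % (m - n))) x = (f ^ k) x
  conv_rhs => rw [← Int.emod_add_mul_ediv k (m - n), zpow_add, Equiv.Perm.mul_apply, hq]

/-- If half of an orbit stays in a bounded interval then the orbit is finite. -/
theorem zpowOrbit_finite_of_mem_Ico {f : Equiv.Perm ℤ} {x a b e : ℤ} (he : e ≠ 0)
    (h : ∀ n : ℕ, (f ^ (e * n)) x ∈ Ico a b) : (zpowOrbit f x).Finite := by
  obtain ⟨m, -, n, -, hmn, heq⟩ := Set.infinite_univ.exists_ne_map_eq_of_mapsTo
    (f := fun n : ℕ => (f ^ (e * n)) x) (fun n _ => h n) (Set.finite_Ico a b)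
  refine zpowOrbit_finite_of_zpow_eq (m := e * m) (n := e * n) ?_ heq
  simpa [he] using hmn

theorem le_pow_apply {f : Equiv.Perm ℤ} {p : ℤ} (h : ∀ x, p ≤ x → p ≤ f x) (n : ℕ) {x : ℤ}
    (hx : p ≤ x) : p ≤ (f ^ n) x := by
  induction n with
  | zero => simpa
  | succ n ih =>
    rw [pow_succ', Equiv.Perm.mul_apply]
    exact h _ ih

/-- An infinite orbit crosses from below `p` to above `p`, when `f` maps upper half-lines with
arbitrarily large and arbitrarily small endpoints into themselves. -/
theorem exists_crossing {f : Equiv.Perm ℤ} (p : ℤ)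
    (hup : ∀ N, ∃ q, N ≤ q ∧ ∀ x, q ≤ x → q ≤ f x)
    (hdown : ∀ N, ∃ q, q ≤ N ∧ ∀ x, q ≤ x → q ≤ f x)
    (hp : ∀ x, p ≤ x → p ≤ f x) {x : ℤ} (hx : (zpowOrbit f x).Infinite) :
    ∃ m : ℤ, (f ^ m) x < p ∧ p ≤ f ((f ^ m) x) := by
  by_contra! hcon
  have hstep : ∀ m : ℤ, p ≤ (f ^ (m + 1)) x ↔ p ≤ (f ^ m) x := by
    intro m
    rw [add_comm, zpow_add, zpow_one, Equiv.Perm.mul_apply]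
    refine ⟨fun h => ?_, hp _⟩
    by_contra! h'
    exact absurd h (not_le.mpr (hcon m h'))
  have hall : ∀ m : ℤ, p ≤ (f ^ m) x ↔ p ≤ x := by
    intro m
    induction m using Int.induction_on with
    | zero => simp
    | succ m ih => rw [hstep, ih]
    | pred m ih => rw [← ih, ← hstep, sub_add_cancel]
  by_cases hpx : p ≤ x
  · obtain ⟨q, hq, hqf⟩ := hup (x + 1)
    refine hx (zpowOrbit_finite_of_mem_Ico (a := p) (b := q) (e := -1) (by norm_num) fun n => ?_)
    refine ⟨(hall _).mpr hpx, ?_⟩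
    by_contra! hle
    have := le_pow_apply hqf n hle
    have h2 : (f ^ n) ((f ^ (-1 * (n : ℤ))) x) = x := by simp
    omega
  · obtain ⟨q, hq, hqf⟩ := hdown x
    refine hx (zpowOrbit_finite_of_mem_Ico (a := q) (b := p) (e := 1) (by norm_num) fun n => ?_)
    refine ⟨?_, not_le.mp (mt (hall _).mp hpx)⟩
    simpa using le_pow_apply hqf n hq

/-- If `f` maps arbitrarily high and arbitrarily low half-lines `[p, ∞)` onto `[p + c, ∞)`, with
`0 ≤ c`, then `f` has exactly `c` infinite orbits. -/
theorem infinite_orbits_of_halfLines (f : Equiv.Perm ℤ) (c : ℕ)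
    (hup : ∀ N : ℤ, ∃ p, N ≤ p ∧ ∀ x, p + c ≤ f x ↔ p ≤ x)
    (hdown : ∀ N : ℤ, ∃ p, p ≤ N ∧ ∀ x, p + c ≤ f x ↔ p ≤ x) :
    {S : Set ℤ | (∃ x : ℤ, S = zpowOrbit f x) ∧ S.Infinite}.Finite ∧
    {S : Set ℤ | (∃ x : ℤ, S = zpowOrbit f x) ∧ S.Infinite}.ncard = c := by
  have hinv : ∀ p : ℤ, (∀ x, p + c ≤ f x ↔ p ≤ x) → ∀ x, p ≤ x → p ≤ f x := by
    intro p h x hx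
    have := (h x).mpr hx
    omega
  obtain ⟨p, -, hp⟩ := hup 0
  have hpos : ∀ (y : ℤ), p ≤ y → ∀ n : ℕ, p + c ≤ (f ^ (n + 1)) y := by
    intro y hy n
    rw [pow_succ', Equiv.Perm.mul_apply, hp]
    exact le_pow_apply (hinv p hp) n hy
  have hunique : ∀ (y z m : ℤ), y ∈ Ico p (p + c) → z ∈ Ico p (p + c) →
      (f ^ m) y = z → m = 0 := by
    intro y z m hy hz h
    rcases lt_trichotomy m 0 with hm | hm | hm
    · obtain ⟨n, rfl⟩ : ∃ n : ℕ, m = -((n + 1 : ℕ) : ℤ) := ⟨(-m - 1).toNat, by omega⟩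
      have h2 : (f ^ (n + 1)) z = y := by
        rwa [zpow_neg, zpow_natCast, Equiv.Perm.inv_eq_iff_eq, eq_comm] at h
      have := hpos z hz.1 n
      have := hy.2
      omega
    · exact hm
    · obtain ⟨n, rfl⟩ : ∃ n : ℕ, m = ((n + 1 : ℕ) : ℤ) := ⟨(m - 1).toNat, by omega⟩
      have h2 : (f ^ (n + 1)) y = z := by simpa only [zpow_natCast] using h
      have := hpos y hy.1 n
      have := hz.2
      omega
  have hset : {S : Set ℤ | (∃ x : ℤ, S = zpowOrbit f x) ∧ S.Infinite}
      = zpowOrbit f '' Ico p (p + c) := by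
    ext S
    constructor
    · rintro ⟨⟨x, rfl⟩, hx⟩
      obtain ⟨m, hm1, hm2⟩ := exists_crossing p
        (fun N => (hup N).imp fun q hq => ⟨hq.1, hinv q hq.2⟩)
        (fun N => (hdown N).imp fun q hq => ⟨hq.1, hinv q hq.2⟩) (hinv p hp) hx
      refine ⟨f ((f ^ m) x), ⟨hm2, ?_⟩, ?_⟩
      · exact not_le.mp (mt (hp _).mp (not_le.mpr hm1))
      · rw [← Equiv.Perm.mul_apply, ← zpow_one_add, zpowOrbit_zpow_apply]
    · rintro ⟨y, hy, rfl⟩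
      refine ⟨⟨y, rfl⟩, Set.infinite_range_of_injective fun m n hmn => ?_⟩
      have h : (f ^ (m - n)) y = y := zpow_sub_apply_eq_self hmn
      have := hunique y y _ hy hy h
      omega
  have hinj : Set.InjOn (zpowOrbit f) (Ico p (p + c)) := by
    intro y hy z hz hyz
    have hzmem : z ∈ zpowOrbit f y := hyz ▸ ⟨0, by simp⟩
    obtain ⟨m, hm⟩ := hzmem
    have hm0 := hunique y z m hy hz hm
    subst hm0
    simpa using hm
  rw [hset]
  refine ⟨(Set.finite_Ico _ _).image _, ?_⟩
  rw [hinj.ncard_image, ← Finset.coe_Ico, Set.ncard_coe_finset, Int.card_Ico]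
  omega

/-- If `f` has displacement at most `M` and both `f` and `f⁻¹` act as translations by `±c` on
`[p, p + M]`, then `f` maps the half-line `[p, ∞)` onto `[p + c, ∞)`. -/
theorem halfLine_iff_of_translation {f : Equiv.Perm ℤ} {M c p : ℤ} (hc : 0 ≤ c)
    (hM : ∀ x, |f x - x| ≤ M) (hf : ∀ x ∈ Icc p (p + M), f x = x + c)
    (hf' : ∀ x ∈ Icc p (p + M), f⁻¹ x = x - c) (x : ℤ) : p + c ≤ f x ↔ p ≤ x := by
  have hxM := abs_le.mp (hM x)
  have hpM := abs_le.mp (hM p)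
  have hp := hf p ⟨le_rfl, by omega⟩
  have h1 : p ≤ x → x ≤ p + M → f x = x + c := fun h h' => hf x ⟨h, h'⟩
  have h2 : p ≤ f x → f x ≤ p + M → x = f x - c := fun h h' => by
    simpa using hf' (f x) ⟨h, h'⟩
  omega

section Words

variable {r : ℕ} {ρ : FreeGroup (Fin (r + 1)) →* Equiv.Perm ℤ} {R : ℕ}

theorem abs_letter_apply_sub_le (hA : ρ (FreeGroup.of 0) = Equiv.addRight (1 : ℤ)) (hR1 : 1 ≤ R)
    (hR : ∀ j : Fin (r + 1), j ≠ 0 → ∀ n : ℤ, |ρ (FreeGroup.of j) n - n| ≤ (R : ℤ))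
    (l : Fin (r + 1) × Bool) (x : ℤ) : |ρ (FreeGroup.mk [l]) x - x| ≤ R := by
  have hof : ∀ (j : Fin (r + 1)) (n : ℤ), |ρ (FreeGroup.of j) n - n| ≤ (R : ℤ) := by
    intro j n
    by_cases hj : j = 0
    · subst hj
      simpa [hA] using hR1
    · exact hR j hj n
  obtain ⟨j, b⟩ := l
  cases b with
  | true => exact hof j x
  | false =>
    have h : FreeGroup.mk [(j, false)] = (FreeGroup.of j)⁻¹ := rfl
    have := hof j ((ρ (FreeGroup.of j))⁻¹ x)
    rw [← Equiv.Perm.mul_apply, mul_inv_cancel, Equiv.Perm.one_apply] at this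
    rwa [h, map_inv, abs_sub_comm]

theorem letter_apply_eq_add_aCount (hA : ρ (FreeGroup.of 0) = Equiv.addRight (1 : ℤ)) {x : ℤ}
    (hx : ∀ j : Fin (r + 1), j ≠ 0 → ρ (FreeGroup.of j) x = x) (l : Fin (r + 1) × Bool) :
    ρ (FreeGroup.mk [l]) x = x + (aCount r (FreeGroup.mk [l])).toAdd := by
  obtain ⟨j, b⟩ := l
  have hcount : (aCount r (FreeGroup.of j)).toAdd = if j = 0 then 1 else 0 := by
    simp [aCount]
  cases b with
  | true =>
    change ρ (FreeGroup.of j) x = x + (aCount r (FreeGroup.of j)).toAdd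
    rw [hcount]
    by_cases hj : j = 0
    · subst hj
      simp [hA]
    · simp [hj, hx j hj]
  | false =>
    have h : FreeGroup.mk [(j, false)] = (FreeGroup.of j)⁻¹ := rfl
    rw [h, map_inv, map_inv, toAdd_inv, hcount, Equiv.Perm.inv_eq_iff_eq]
    by_cases hj : j = 0
    · subst hj
      simp [hA]
    · simp [hj, hx j hj]

theorem abs_apply_sub_le_mul_norm (hA : ρ (FreeGroup.of 0) = Equiv.addRight (1 : ℤ))
    (hR1 : 1 ≤ R)
    (hR : ∀ j : Fin (r + 1), j ≠ 0 → ∀ n : ℤ, |ρ (FreeGroup.of j) n - n| ≤ (R : ℤ))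
    (w : FreeGroup (Fin (r + 1))) (x : ℤ) : |ρ w x - x| ≤ R * w.norm := by
  have key : ∀ L : List (Fin (r + 1) × Bool), |ρ (FreeGroup.mk L) x - x| ≤ R * L.length := by
    intro L
    induction L with
    | nil => simp [← FreeGroup.one_eq_mk]
    | cons l L ih =>
      have hl : FreeGroup.mk (l :: L) = FreeGroup.mk [l] * FreeGroup.mk L := rfl
      rw [hl, map_mul, Equiv.Perm.mul_apply]
      have := abs_letter_apply_sub_le hA hR1 hR l (ρ (FreeGroup.mk L) x)
      have := abs_sub_le (ρ (FreeGroup.mk [l]) (ρ (FreeGroup.mk L) x)) (ρ (FreeGroup.mk L) x) x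
      push_cast [List.length_cons]
      linarith
  simpa [FreeGroup.norm, FreeGroup.mk_toWord] using key w.toWord

/-- Words translate by `aCount` the points that stay, letter by letter, within a set on which all
generators other than the shift act trivially. -/
theorem apply_eq_add_aCount (hA : ρ (FreeGroup.of 0) = Equiv.addRight (1 : ℤ)) (hR1 : 1 ≤ R)
    (hR : ∀ j : Fin (r + 1), j ≠ 0 → ∀ n : ℤ, |ρ (FreeGroup.of j) n - n| ≤ (R : ℤ))
    {J : Set ℤ} (hJ : ∀ j : Fin (r + 1), j ≠ 0 → ∀ n ∈ J, ρ (FreeGroup.of j) n = n)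
    (w : FreeGroup (Fin (r + 1))) {x : ℤ} (hx : Icc (x - R * w.norm) (x + R * w.norm) ⊆ J) :
    ρ w x = x + (aCount r w).toAdd := by
  have key : ∀ L : List (Fin (r + 1) × Bool), Icc (x - R * L.length) (x + R * L.length) ⊆ J →
      ρ (FreeGroup.mk L) x = x + (aCount r (FreeGroup.mk L)).toAdd := by
    intro L hL
    induction L with
    | nil => simp [← FreeGroup.one_eq_mk]
    | cons l L ih =>
      push_cast [List.length_cons] at hL
      have hl : FreeGroup.mk (l :: L) = FreeGroup.mk [l] * FreeGroup.mk L := rfl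
      have hdisp := abs_le.mp <| (abs_apply_sub_le_mul_norm hA hR1 hR (FreeGroup.mk L) x).trans
        (mul_le_mul_of_nonneg_left (Nat.cast_le.mpr FreeGroup.norm_mk_le) (Nat.cast_nonneg R))
      have ih' := ih ((Icc_subset_Icc (by nlinarith) (by nlinarith)).trans hL)
      have hmem : ρ (FreeGroup.mk L) x ∈ J := hL ⟨by nlinarith, by nlinarith⟩
      rw [hl, map_mul, Equiv.Perm.mul_apply,
        letter_apply_eq_add_aCount hA (fun j hj => hJ j hj _ hmem) l, ih', map_mul, toAdd_mul]
      ring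
  have := key w.toWord (by simpa [FreeGroup.norm] using hx)
  simpa [FreeGroup.mk_toWord] using this

end Words

theorem halfLine_iff_of_fixed {r : ℕ} {ρ : FreeGroup (Fin (r + 1)) →* Equiv.Perm ℤ} {R : ℕ}
    (hA : ρ (FreeGroup.of 0) = Equiv.addRight (1 : ℤ)) (hR1 : 1 ≤ R)
    (hR : ∀ j : Fin (r + 1), j ≠ 0 → ∀ n : ℤ, |ρ (FreeGroup.of j) n - n| ≤ (R : ℤ))
    (w : FreeGroup (Fin (r + 1))) (hc : 0 ≤ (aCount r w).toAdd) {p : ℤ}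
    (hJ : ∀ j : Fin (r + 1), j ≠ 0 → ∀ n ∈ Icc (p - R * w.norm) (p + 2 * (R * w.norm)),
      ρ (FreeGroup.of j) n = n) (x : ℤ) :
    p + (aCount r w).toAdd ≤ ρ w x ↔ p ≤ x := by
  refine halfLine_iff_of_translation hc (abs_apply_sub_le_mul_norm hA hR1 hR w) ?_ ?_ x
  · rintro y ⟨hy1, hy2⟩
    exact apply_eq_add_aCount hA hR1 hR hJ w (Icc_subset_Icc (by linarith) (by linarith))
  · rintro y ⟨hy1, hy2⟩
    rw [← map_inv, apply_eq_add_aCount hA hR1 hR hJ w⁻¹, map_inv, toAdd_inv, sub_eq_add_neg]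
    rw [FreeGroup.norm_inv_eq]
    exact Icc_subset_Icc (by linarith) (by linarith)

theorem infinite_orbits_of_aCount_nonneg {r : ℕ} {Z : ZebraDecomp}
    {ρ : FreeGroup (Fin (r + 1)) →* Equiv.Perm ℤ}
    (hA : ρ (FreeGroup.of 0) = Equiv.addRight (1 : ℤ))
    (hB : ∀ j : Fin (r + 1), j ≠ 0 → IsZebraPerm Z (ρ (FreeGroup.of j)))
    {R : ℕ}
    (hR : ∀ j : Fin (r + 1), j ≠ 0 → ∀ n : ℤ, |ρ (FreeGroup.of j) n - n| ≤ (R : ℤ))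
    (w : FreeGroup (Fin (r + 1)))
    (hw : ∀ k : ℤ, 3 * (R : ℤ) * (FreeGroup.norm w : ℤ) < Z.br k - Z.bl k + 1)
    (hc : 0 ≤ (aCount r w).toAdd) :
    {S : Set ℤ | (∃ x : ℤ, S = zpowOrbit (ρ w) x) ∧ S.Infinite}.Finite ∧
    {S : Set ℤ | (∃ x : ℤ, S = zpowOrbit (ρ w) x) ∧ S.Infinite}.ncard
      = (aCount r w).toAdd.natAbs := by
  rcases Nat.eq_zero_or_pos R with rfl | hR1
  · have hfix : ∀ j : Fin (r + 1), j ≠ 0 → ∀ n : ℤ, ρ (FreeGroup.of j) n = n := by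
      intro j hj n
      have := abs_le.mp (hR j hj n)
      push_cast at this
      omega
    have h := fun p : ℤ => halfLine_iff_of_fixed (p := p) hA le_rfl
      (fun j hj n => by simp [hfix j hj n]) w hc fun j hj n _ => hfix j hj n
    refine infinite_orbits_of_halfLines _ _ (fun N => ⟨N, le_rfl, ?_⟩) fun N => ⟨N, le_rfl, ?_⟩
    all_goals
      rw [Int.natAbs_of_nonneg hc]
      exact h N
  · have h : ∀ k x, Z.bl k + R * w.norm + (aCount r w).toAdd ≤ ρ w x ↔
        Z.bl k + R * w.norm ≤ x := by
      intro k
      refine halfLine_iff_of_fixed hA hR1 hR w hc fun j hj n hn => (hB j hj).2 k n ?_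
      have := hw k
      exact ⟨by linarith [hn.1], by linarith [hn.2]⟩
    refine infinite_orbits_of_halfLines _ _ (fun N => ?_) fun N => ?_
    all_goals
      rw [Int.natAbs_of_nonneg hc]
      obtain ⟨k, hk1, hk2⟩ := Z.covers (N - R * w.norm)
    · exact ⟨_, by linarith, h (k + 1)⟩
    · exact ⟨_, by linarith, h k⟩

/-- **Combinatorial Lemma (infinite orbits of zebra dynamics).**
Let `Γ_{r+1}` (free with basis `a = of 0`, `bⱼ = of j` for `j ≠ 0`) act on `ℤ` via `ρ`, so that
`a` acts by the shift `n ↦ n + 1` and each `bⱼ` acts by a zebra permutation of one common type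
`Z`.  Let `R` bound the action radii of the `bⱼ` (i.e. `R = max R(bⱼ)` or any larger bound).
If `3 * R * ‖w‖ < s(Z)`, i.e. `3 * R * ‖w‖` is smaller than the width of every black stripe,
then the number of infinite orbits of the cyclic group `⟨w⟩` acting on `ℤ` is exactly
`|c_a(w)|`. -/
theorem zebra_infinite_orbits (r : ℕ) (Z : ZebraDecomp)
    (ρ : FreeGroup (Fin (r + 1)) →* Equiv.Perm ℤ)
    (hA : ρ (FreeGroup.of 0) = Equiv.addRight (1 : ℤ))
    (hB : ∀ j : Fin (r + 1), j ≠ 0 → IsZebraPerm Z (ρ (FreeGroup.of j)))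
    (R : ℕ)
    (hR : ∀ j : Fin (r + 1), j ≠ 0 → ∀ n : ℤ, |ρ (FreeGroup.of j) n - n| ≤ (R : ℤ))
    (w : FreeGroup (Fin (r + 1)))
    (hw : ∀ k : ℤ, 3 * (R : ℤ) * (FreeGroup.norm w : ℤ) < Z.br k - Z.bl k + 1) :
    {S : Set ℤ | (∃ x : ℤ, S = Set.range fun n : ℤ => ((ρ w) ^ n) x) ∧ S.Infinite}.Finite ∧
    {S : Set ℤ | (∃ x : ℤ, S = Set.range fun n : ℤ => ((ρ w) ^ n) x) ∧ S.Infinite}.ncard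
      = (Multiplicative.toAdd (aCount r w)).natAbs := by
  rcases le_total 0 (aCount r w).toAdd with hc | hc
  · exact infinite_orbits_of_aCount_nonneg hA hB hR w hw hc
  · have h := infinite_orbits_of_aCount_nonneg hA hB hR w⁻¹
      (by simpa only [FreeGroup.norm_inv_eq] using hw)
      (by rw [map_inv, toAdd_inv]; omega)
    simp only [map_inv, zpowOrbit_inv, toAdd_inv, Int.natAbs_neg] at h
    exact h
end

section
/- Let T be a nonsingular automorphism of a standard Borel probability space (X, μ). Then the collection V(T) is closed under finite unions and under passing to measurable subsets, and every weakly wandering set for T belongs to V(T); in particular, if W ⊆ X is weakly wandering for T, then (1/n) ∑_{k=0}^{n−1} μ(T^k(W)) → 0 as n → ∞. -/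
open MeasureTheory Filter Set
open scoped ENNReal

/-- `T` is a nonsingular automorphism of `(X, μ)`: a measurable bijection with measurable
inverse such that `μ(T⁻¹(A)) = 0` iff `μ(A) = 0` for all measurable `A`. -/
def Nonsingular {X : Type*} [MeasurableSpace X] (μ : Measure X) (T : Equiv.Perm X) : Prop :=
  Measurable T ∧ Measurable T.symm ∧
    ∀ A : Set X, MeasurableSet A → (μ (⇑T ⁻¹' A) = 0 ↔ μ A = 0)

/-- `W` is weakly wandering for `T`: there is a strictly increasing sequence
`0 = k₀ < k₁ < …` of natural numbers with `μ(T^{kᵢ}(W) ∩ T^{kⱼ}(W)) = 0` for all `i ≠ j`. -/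
def WeaklyWandering {X : Type*} [MeasurableSpace X] (μ : Measure X) (T : Equiv.Perm X)
    (W : Set X) : Prop :=
  ∃ k : ℕ → ℕ, k 0 = 0 ∧ StrictMono k ∧
    ∀ i j : ℕ, i ≠ j → μ (⇑(T ^ k i) '' W ∩ ⇑(T ^ k j) '' W) = 0

/-- `V(T)`: the collection of measurable sets `A` such that
`(1/n) ∑_{k<n} μ(T^k(A)) → 0`. -/
def VT {X : Type*} [MeasurableSpace X] (μ : Measure X) (T : Equiv.Perm X) : Set (Set X) :=
  {A | MeasurableSet A ∧
    Tendsto (fun n : ℕ => (∑ k ∈ Finset.range n, (μ (⇑(T ^ k) '' A)).toReal) / n)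
      atTop (nhds 0)}

/-- If `0 ≤ a ≤ 1` and all sums of `a` along translates of one infinite set of indices are at
most `1`, then the Cesàro averages of `a` tend to `0`. -/
lemma tendsto_cesaro_zero_of_sum_translate_le_one {a : ℕ → ℝ} (ha0 : ∀ n, 0 ≤ a n)
    (ha1 : ∀ n, a n ≤ 1) {k : ℕ → ℕ}
    (hsum : ∀ m J : ℕ, ∑ j ∈ Finset.range J, a (k j + m) ≤ 1) :
    Tendsto (fun n : ℕ => (∑ i ∈ Finset.range n, a i) / n) atTop (nhds 0) := by
  have hshift (n p : ℕ) : ∑ i ∈ Finset.range n, a i ≤ (∑ m ∈ Finset.range n, a (p + m)) + p := by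
    have h1 : ∑ i ∈ Finset.range n, a i ≤ ∑ i ∈ Finset.range (p + n), a i :=
      Finset.sum_le_sum_of_subset_of_nonneg (Finset.range_mono (Nat.le_add_left n p))
        fun i _ _ => ha0 i
    have h2 : ∑ i ∈ Finset.range p, a i ≤ p := by
      simpa using Finset.sum_le_card_nsmul (Finset.range p) a 1 fun i _ => ha1 i
    rw [Finset.sum_range_add] at h1
    linarith
  have hbound (n J : ℕ) :
      J * ∑ i ∈ Finset.range n, a i ≤ n + ∑ j ∈ Finset.range J, (k j : ℝ) := by
    calc (J : ℝ) * ∑ i ∈ Finset.range n, a i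
        = ∑ _j ∈ Finset.range J, ∑ i ∈ Finset.range n, a i := by simp
      _ ≤ ∑ j ∈ Finset.range J, ((∑ m ∈ Finset.range n, a (k j + m)) + k j) :=
          Finset.sum_le_sum fun j _ => hshift n (k j)
      _ = (∑ m ∈ Finset.range n, ∑ j ∈ Finset.range J, a (k j + m))
            + ∑ j ∈ Finset.range J, (k j : ℝ) := by
          rw [Finset.sum_add_distrib, Finset.sum_comm]
      _ ≤ n + ∑ j ∈ Finset.range J, (k j : ℝ) := by
          gcongr
          simpa using Finset.sum_le_card_nsmul (Finset.range n) _ 1 fun m _ => hsum m J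
  rw [Metric.tendsto_atTop]
  intro ε hε
  obtain ⟨J, hJ⟩ := exists_nat_gt (2 / ε)
  obtain ⟨N, hN⟩ := exists_nat_gt (∑ j ∈ Finset.range J, (k j : ℝ))
  refine ⟨N + 1, fun n hn => ?_⟩
  have hn0 : (0 : ℝ) < n := by exact_mod_cast (show 0 < n by omega)
  have hNn : (N : ℝ) ≤ n := by exact_mod_cast (show N ≤ n by omega)
  have hJ0 : (0 : ℝ) < J := (by positivity : 0 < 2 / ε).trans hJ
  have hJε : 2 < J * ε := (div_lt_iff₀ hε).1 hJ
  rw [Real.dist_eq, sub_zero,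
    abs_of_nonneg (div_nonneg (Finset.sum_nonneg fun i _ => ha0 i) hn0.le), div_lt_iff₀ hn0]
  refine lt_of_mul_lt_mul_left ?_ hJ0.le
  nlinarith [hbound n J, mul_lt_mul_of_pos_right hJε hn0]

namespace Nonsingular

variable {X : Type*} [MeasurableSpace X] {μ : Measure X} {T : Equiv.Perm X}

lemma measurableSet_image_pow (hT : Nonsingular μ T) {A : Set X} (hA : MeasurableSet A) (n : ℕ) :
    MeasurableSet (⇑(T ^ n) '' A) := by
  induction n with
  | zero => simpa using hA
  | succ n ih =>
    rw [pow_succ', Equiv.Perm.coe_mul, image_comp, Equiv.image_eq_preimage_symm T]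
    exact hT.2.1 ih

lemma measure_image_pow_eq_zero (hT : Nonsingular μ T) {A : Set X} (hA : MeasurableSet A)
    (h0 : μ A = 0) (n : ℕ) : μ (⇑(T ^ n) '' A) = 0 := by
  induction n with
  | zero => simpa using h0
  | succ n ih =>
    rw [← hT.2.2 _ (hT.measurableSet_image_pow hA _), pow_succ', Equiv.Perm.coe_mul, image_comp,
      preimage_image_eq _ T.injective]
    exact ih

lemma sum_measure_image_translate_le_one [IsProbabilityMeasure μ] (hT : Nonsingular μ T)
    {W : Set X} (hW : MeasurableSet W) {k : ℕ → ℕ}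
    (hk : ∀ i j : ℕ, i ≠ j → μ (⇑(T ^ k i) '' W ∩ ⇑(T ^ k j) '' W) = 0) (m J : ℕ) :
    ∑ j ∈ Finset.range J, μ.real (⇑(T ^ (k j + m)) '' W) ≤ 1 := by
  have hdisj : Pairwise fun i j => AEDisjoint μ (⇑(T ^ (k i + m)) '' W) (⇑(T ^ (k j + m)) '' W) := by
    intro i j hij
    have h := hT.measure_image_pow_eq_zero
      ((hT.measurableSet_image_pow hW (k i)).inter (hT.measurableSet_image_pow hW (k j)))
      (hk i j hij) m
    rwa [image_inter (T ^ m).injective, ← image_comp, ← image_comp, ← Equiv.Perm.coe_mul,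
      ← Equiv.Perm.coe_mul, ← pow_add, ← pow_add, add_comm m, add_comm m] at h
  rw [← measureReal_biUnion_finset₀ (fun i _ j _ hij => hdisj hij)
    fun j _ => (hT.measurableSet_image_pow hW _).nullMeasurableSet]
  exact measureReal_le_one

end Nonsingular

lemma WeaklyWandering.mem_VT {X : Type*} [MeasurableSpace X] {μ : Measure X}
    [IsProbabilityMeasure μ] {T : Equiv.Perm X} (hT : Nonsingular μ T) {W : Set X}
    (hW : MeasurableSet W) (hww : WeaklyWandering μ T W) : W ∈ VT μ T := by
  obtain ⟨k, -, -, hk⟩ := hww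
  exact ⟨hW, tendsto_cesaro_zero_of_sum_translate_le_one (fun _ => measureReal_nonneg)
    (fun _ => measureReal_le_one) (hT.sum_measure_image_translate_le_one hW hk)⟩

lemma VT_union {X : Type*} [MeasurableSpace X] {μ : Measure X} [IsFiniteMeasure μ]
    {T : Equiv.Perm X} {A B : Set X} (hA : A ∈ VT μ T) (hB : B ∈ VT μ T) : A ∪ B ∈ VT μ T := by
  refine ⟨hA.1.union hB.1, squeeze_zero (fun n => by positivity) (fun n => ?_)
    (by simpa using hA.2.add hB.2)⟩
  rw [← add_div, ← Finset.sum_add_distrib]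
  gcongr with i
  rw [image_union]
  exact measureReal_union_le _ _

lemma VT_subset {X : Type*} [MeasurableSpace X] {μ : Measure X} [IsFiniteMeasure μ]
    {T : Equiv.Perm X} {A B : Set X} (hA : A ∈ VT μ T) (hB : MeasurableSet B) (hBA : B ⊆ A) :
    B ∈ VT μ T := by
  refine ⟨hB, squeeze_zero (fun n => by positivity) (fun n => ?_) hA.2⟩
  gcongr with i
  exact measure_ne_top _ _

/-- **Properties of `V(T)`.**  For a nonsingular automorphism `T` of a standard Borel
probability space `(X, μ)`, the collection `V(T)` is closed under finite unions and under
passing to measurable subsets, and every weakly wandering measurable set belongs to `V(T)`;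
in particular for every weakly wandering measurable set `W` the Cesàro averages
`(1/n) ∑_{k<n} μ(T^k(W))` tend to `0`. -/
theorem VT_union_subset_weaklyWandering {X : Type*} [MeasurableSpace X] [StandardBorelSpace X]
    (μ : Measure X) [IsProbabilityMeasure μ] (T : Equiv.Perm X) (hT : Nonsingular μ T) :
    (∀ A B : Set X, A ∈ VT μ T → B ∈ VT μ T → A ∪ B ∈ VT μ T) ∧
    (∀ A B : Set X, A ∈ VT μ T → MeasurableSet B → B ⊆ A → B ∈ VT μ T) ∧
    (∀ W : Set X, MeasurableSet W → WeaklyWandering μ T W → W ∈ VT μ T) ∧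
    (∀ W : Set X, MeasurableSet W → WeaklyWandering μ T W →
      Tendsto (fun n : ℕ => (∑ k ∈ Finset.range n, (μ (⇑(T ^ k) '' W)).toReal) / n)
        atTop (nhds 0)) := by
  exact ⟨fun _ _ => VT_union, fun _ _ => VT_subset, fun _ hW h => h.mem_VT hT hW,
    fun _ hW h => (h.mem_VT hT hW).2⟩
end

section
/- Let T be a nonsingular ergodic automorphism of a standard Borel probability space (X, μ) that admits a weakly wandering set of positive measure. Then for all measurable sets U, B ⊆ X and every ε > 0 there exist a measurable set A ⊆ X and an integer n ≥ 1 such that μ(T^n(A) Δ U) < ε and μ(A Δ B) < ε. -/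
open MeasureTheory Filter Set
open scoped ENNReal symmDiff

/-- `T` is ergodic: any measurable set `A` with `μ(T⁻¹(A) Δ A) = 0` has measure `0` or `1`. -/
def ErgodicNS {X : Type*} [MeasurableSpace X] (μ : Measure X) (T : Equiv.Perm X) : Prop :=
  ∀ A : Set X, MeasurableSet A → μ ((⇑T ⁻¹' A) ∆ A) = 0 → μ A = 0 ∨ μ A = 1

theorem Nonsingular.measurable_zpow {X : Type*} [MeasurableSpace X] {μ : Measure X}
    {T : Equiv.Perm X} (hT : Nonsingular μ T) (j : ℤ) : Measurable ⇑(T ^ j) := by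
  induction j with
  | zero => exact measurable_id
  | succ n ih => rw [zpow_add_one, Equiv.Perm.coe_mul]; exact ih.comp hT.1
  | pred n ih => rw [zpow_sub_one, Equiv.Perm.coe_mul]; exact ih.comp hT.2.1

theorem Nonsingular.measure_preimage_inv_eq_zero {X : Type*} [MeasurableSpace X]
    {μ : Measure X} {T : Equiv.Perm X} (hT : Nonsingular μ T) {A : Set X}
    (hA : MeasurableSet A) (h : μ A = 0) : μ (⇑T⁻¹ ⁻¹' A) = 0 := by
  refine (hT.2.2 _ (hT.2.1 hA)).1 ?_
  rw [← preimage_comp]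
  exact T.symm_comp_self ▸ h

theorem Nonsingular.measure_preimage_zpow_eq_zero {X : Type*} [MeasurableSpace X]
    {μ : Measure X} {T : Equiv.Perm X} (hT : Nonsingular μ T) (j : ℤ) {A : Set X}
    (hA : MeasurableSet A) (h : μ A = 0) : μ (⇑(T ^ j) ⁻¹' A) = 0 := by
  induction j with
  | zero => exact h
  | succ n ih =>
    rw [zpow_add_one, Equiv.Perm.coe_mul, preimage_comp]
    exact (hT.2.2 _ (hT.measurable_zpow _ hA)).2 ih
  | pred n ih =>
    rw [zpow_sub_one, Equiv.Perm.coe_mul, preimage_comp]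
    exact hT.measure_preimage_inv_eq_zero (hT.measurable_zpow _ hA) ih

theorem Equiv.Perm.image_pow_eq_preimage_zpow {X : Type*} (T : Equiv.Perm X) (n : ℕ)
    (A : Set X) : ⇑(T ^ n) '' A = ⇑(T ^ (-(n : ℤ))) ⁻¹' A := by
  rw [Equiv.image_eq_preimage_symm, zpow_neg, zpow_natCast]
  rfl

theorem Equiv.Perm.preimage_zpow_preimage_zpow {X : Type*} (T : Equiv.Perm X) (i j : ℤ)
    (A : Set X) : ⇑(T ^ i) ⁻¹' (⇑(T ^ j) ⁻¹' A) = ⇑(T ^ (i + j)) ⁻¹' A := by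
  rw [← preimage_comp, ← Equiv.Perm.coe_mul, ← zpow_add, add_comm]

/-- The images of every translate of a weakly wandering set become small along a wandering
sequence. -/
theorem Nonsingular.tendsto_measure_image_translate {X : Type*} [MeasurableSpace X]
    {μ : Measure X} [IsFiniteMeasure μ] {T : Equiv.Perm X} (hT : Nonsingular μ T) {W : Set X}
    (hW : MeasurableSet W) {k : ℕ → ℕ}
    (hk : ∀ i j : ℕ, i ≠ j → μ (⇑(T ^ k i) '' W ∩ ⇑(T ^ k j) '' W) = 0) (j : ℤ) :
    Tendsto (fun i => μ (⇑(T ^ k i) '' (⇑(T ^ j) ⁻¹' W))) atTop (nhds 0) := by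
  have hcomm (i : ℕ) : ⇑(T ^ k i) '' (⇑(T ^ j) ⁻¹' W) = ⇑(T ^ j) ⁻¹' (⇑(T ^ k i) '' W) := by
    simp only [Equiv.Perm.image_pow_eq_preimage_zpow, Equiv.Perm.preimage_zpow_preimage_zpow,
      add_comm]
  have hmeas (i : ℕ) : MeasurableSet (⇑(T ^ k i) '' W) := by
    rw [Equiv.Perm.image_pow_eq_preimage_zpow]
    exact hT.measurable_zpow _ hW
  simp only [hcomm]
  refine ENNReal.tendsto_atTop_zero_of_tsum_ne_top ?_
  rw [← measure_iUnion₀]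
  · exact measure_ne_top _ _
  · intro a b hab
    exact hT.measure_preimage_zpow_eq_zero j ((hmeas a).inter (hmeas b)) (hk a b hab)
  · exact fun i => (hT.measurable_zpow j (hmeas i)).nullMeasurableSet

/-- By ergodicity, finitely many translates of a set of positive measure cover the space up to
measure `ε`. -/
theorem ErgodicNS.exists_finset_measure_compl_lt {X : Type*} [MeasurableSpace X]
    {μ : Measure X} [IsProbabilityMeasure μ] {T : Equiv.Perm X} (hT : Nonsingular μ T)
    (hTerg : ErgodicNS μ T) {W : Set X} (hW : MeasurableSet W) (hpos : 0 < μ W) {ε : ℝ≥0∞}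
    (hε : 0 < ε) : ∃ t : Finset ℤ, μ (⋃ j ∈ t, ⇑(T ^ j) ⁻¹' W)ᶜ < ε := by
  have hmeas (j : ℤ) : MeasurableSet (⇑(T ^ j) ⁻¹' W) := hT.measurable_zpow j hW
  have hinv : ⇑T ⁻¹' (⋃ j : ℤ, ⇑(T ^ j) ⁻¹' W) = ⋃ j : ℤ, ⇑(T ^ j) ⁻¹' W := by
    rw [preimage_iUnion]
    refine iUnion_congr_of_surjective _ (Equiv.addLeft (1 : ℤ)).surjective fun j => ?_
    simpa using (T.preimage_zpow_preimage_zpow 1 j W).symm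
  have hone : μ (⋃ j : ℤ, ⇑(T ^ j) ⁻¹' W) = 1 := by
    refine (hTerg _ (MeasurableSet.iUnion hmeas) (by simp [hinv])).resolve_left fun h => ?_
    exact hpos.ne' (measure_mono_null (subset_iUnion (fun j : ℤ => ⇑(T ^ j) ⁻¹' W) 0) h)
  have hanti : Antitone fun t : Finset ℤ => (⋃ j ∈ t, ⇑(T ^ j) ⁻¹' W)ᶜ := fun s t hst =>
    compl_subset_compl.2 (biUnion_subset_biUnion_left hst)
  have hlim := tendsto_measure_iInter_atTop (μ := μ)
    (fun t => (t.measurableSet_biUnion fun j _ => hmeas j).compl.nullMeasurableSet)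
    hanti ⟨∅, measure_ne_top _ _⟩
  have hzero : μ (⋂ t : Finset ℤ, (⋃ j ∈ t, ⇑(T ^ j) ⁻¹' W)ᶜ) = 0 := by
    rw [← compl_iUnion, ← iUnion_eq_iUnion_finset,
      prob_compl_eq_zero_iff (MeasurableSet.iUnion hmeas), hone]
  rw [hzero] at hlim
  exact (hlim.eventually_lt_const hε).exists

/-- **Approximate transitivity step (Krengel).**  Let `T` be a nonsingular ergodic
automorphism of a standard Borel probability space `(X, μ)` admitting a weakly wandering set
of positive measure.  Then for all measurable `U, B ⊆ X` and every `ε > 0` there exist a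
measurable set `A` and an integer `n ≥ 1` with `μ(Tⁿ(A) Δ U) < ε` and `μ(A Δ B) < ε`. -/
theorem krengel_approx {X : Type*} [MeasurableSpace X] [StandardBorelSpace X]
    (μ : Measure X) [IsProbabilityMeasure μ] (T : Equiv.Perm X)
    (hT : Nonsingular μ T) (hTerg : ErgodicNS μ T)
    (hW : ∃ W : Set X, MeasurableSet W ∧ WeaklyWandering μ T W ∧ 0 < μ W) :
    ∀ U B : Set X, MeasurableSet U → MeasurableSet B → ∀ ε : ℝ≥0∞, 0 < ε →
      ∃ A : Set X, MeasurableSet A ∧ ∃ n : ℕ, 1 ≤ n ∧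
        μ ((⇑(T ^ n) '' A) ∆ U) < ε ∧ μ (A ∆ B) < ε := by
  obtain ⟨W, hWm, ⟨k, -, hkmono, hk⟩, hpos⟩ := hW
  intro U B hU hB ε hε
  obtain ⟨t, ht⟩ := ErgodicNS.exists_finset_measure_compl_lt hT hTerg hWm hpos hε
  set G := ⋃ j ∈ t, ⇑(T ^ j) ⁻¹' W with hG
  have hGm : MeasurableSet G := t.measurableSet_biUnion fun j _ => hT.measurable_zpow j hWm
  have hlim : Tendsto (fun i => μ (⇑(T ^ k i) '' G)) atTop (nhds 0) := by
    have hsum := tendsto_finsetSum t fun j _ => hT.tendsto_measure_image_translate hWm hk j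
    rw [Finset.sum_const_zero] at hsum
    refine tendsto_of_tendsto_of_tendsto_of_le_of_le tendsto_const_nhds hsum
      (fun _ => zero_le) fun i => ?_
    simp only [hG, image_iUnion]
    exact measure_biUnion_finset_le t _
  obtain ⟨i, hi, hi1⟩ := ((hlim.eventually_lt_const hε).and (eventually_ge_atTop 1)).exists
  refine ⟨(B ∩ G) ∪ (⇑(T ^ k i) ⁻¹' U \ G), (hB.inter hGm).union ?_, k i,
    hi1.trans hkmono.le_apply, (measure_mono ?_).trans_lt hi, (measure_mono ?_).trans_lt ht⟩
  · have := hT.measurable_zpow (k i) hU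
    rw [zpow_natCast] at this
    exact this.diff hGm
  · rw [image_union, image_sdiff (T ^ k i).injective, image_preimage_eq _ (T ^ k i).surjective]
    have hsub : ⇑(T ^ k i) '' (B ∩ G) ⊆ ⇑(T ^ k i) '' G := image_mono inter_subset_right
    rintro x (⟨h | h, hxU⟩ | ⟨hxU, h⟩)
    · exact hsub h
    · exact absurd h.1 hxU
    · by_contra hx
      exact h (Or.inr ⟨hxU, hx⟩)
  · rintro x (⟨h | h, hxB⟩ | ⟨hxB, h⟩) hx
    · exact hxB h.1
    · exact h.2 hx
    · exact h (Or.inl ⟨hxB, hx⟩)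
end

section
/- Let T be a nonsingular ergodic automorphism of a standard Borel probability space (X, μ) that admits a weakly wandering set of positive measure. Then there exists a measurable set A ⊆ X whose T-orbit is dense in the measure algebra: for every measurable set U ⊆ X and every ε > 0 there exists n ∈ ℤ with μ(T^n(A) Δ U) < ε. -/
open MeasureTheory Filter Set
open scoped ENNReal symmDiff

theorem zpow_image_zpow_image {X : Type*} (T : Equiv.Perm X) (m n : ℤ) (A : Set X) :
    ⇑(T ^ m) '' (⇑(T ^ n) '' A) = ⇑(T ^ (m + n)) '' A := by
  rw [zpow_add, Equiv.Perm.coe_mul, Set.image_comp]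

namespace Nonsingular

variable {X : Type*} [MeasurableSpace X] {μ : Measure X} {T : Equiv.Perm X}

theorem measurable_zpow_s7 (hT : Nonsingular μ T) (n : ℤ) : Measurable ⇑(T ^ n) := by
  have hpow : ∀ S : Equiv.Perm X, Measurable S → ∀ k : ℕ, Measurable ⇑(S ^ k) := fun S hS k ↦ by
    rw [Equiv.Perm.coe_pow]
    exact hS.iterate k
  obtain ⟨k, rfl | rfl⟩ := n.eq_nat_or_neg
  · simpa using hpow T hT.1 k
  · rw [zpow_neg, zpow_natCast, ← inv_pow]
    exact hpow T⁻¹ hT.2.1 k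

theorem measurableSet_zpow_image (hT : Nonsingular μ T) (n : ℤ) {A : Set X}
    (hA : MeasurableSet A) : MeasurableSet (⇑(T ^ n) '' A) := by
  have h : ⇑(T ^ n) '' A = ⇑(T ^ (-n)) ⁻¹' A := by
    rw [Equiv.image_eq_preimage_symm, zpow_neg]
    rfl
  exact h ▸ hT.measurable_zpow_s7 (-n) hA

theorem measure_image_eq_zero_iff (hT : Nonsingular μ T) {A : Set X} (hA : MeasurableSet A) :
    μ (⇑T '' A) = 0 ↔ μ A = 0 := by
  have hTA : MeasurableSet (⇑T '' A) := by
    simpa using hT.measurableSet_zpow_image 1 hA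
  rw [← hT.2.2 _ hTA, Set.preimage_image_eq _ T.injective]

theorem measure_zpow_image_eq_zero_iff (hT : Nonsingular μ T) (n : ℤ) {A : Set X}
    (hA : MeasurableSet A) : μ (⇑(T ^ n) '' A) = 0 ↔ μ A = 0 := by
  have hstep : ∀ k : ℤ, μ (⇑(T ^ (k + 1)) '' A) = 0 ↔ μ (⇑(T ^ k) '' A) = 0 := fun k ↦ by
    rw [add_comm, ← zpow_image_zpow_image, zpow_one]
    exact hT.measure_image_eq_zero_iff (hT.measurableSet_zpow_image k hA)
  induction n using Int.induction_on with
  | zero => simp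
  | succ k ih => exact (hstep k).trans ih
  | pred k ih =>
    refine Iff.trans ?_ ih
    rw [← hstep, sub_add_cancel]

/-- Almost everywhere disjointness along `k` is inherited by all translates, so the measures of
the images of a translate tend to zero. -/
theorem tendsto_measure_zpow_image [IsFiniteMeasure μ] (hT : Nonsingular μ T) {W : Set X}
    (hW : MeasurableSet W) {k : ℕ → ℕ}
    (hk : ∀ i j : ℕ, i ≠ j → μ (⇑(T ^ k i) '' W ∩ ⇑(T ^ k j) '' W) = 0) (l : ℤ) :
    Tendsto (fun i ↦ μ (⇑(T ^ (l + k i)) '' W)) atTop (nhds 0) := by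
  apply ENNReal.tendsto_atTop_zero_of_tsum_ne_top
  refine ne_top_of_le_ne_top (measure_ne_top μ _)
    (tsum_meas_le_meas_iUnion_of_disjoint₀ μ
      (fun i ↦ (hT.measurableSet_zpow_image _ hW).nullMeasurableSet) fun i j hij ↦ ?_)
  change μ (⇑(T ^ (l + (k i : ℤ))) '' W ∩ ⇑(T ^ (l + (k j : ℤ))) '' W) = 0
  rw [← zpow_image_zpow_image, ← zpow_image_zpow_image, ← Set.image_inter (T ^ l).injective,
    hT.measure_zpow_image_eq_zero_iff]
  · simpa using hk i j hij
  · exact (hT.measurableSet_zpow_image _ hW).inter (hT.measurableSet_zpow_image _ hW)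

theorem measure_iUnion_zpow_image_eq_one [IsProbabilityMeasure μ] (hT : Nonsingular μ T)
    (hTerg : ErgodicNS μ T) {W : Set X} (hW : MeasurableSet W) (hpos : 0 < μ W) :
    μ (⋃ j : ℤ, ⇑(T ^ j) '' W) = 1 := by
  have hinv : ⇑T ⁻¹' (⋃ j : ℤ, ⇑(T ^ j) '' W) = ⋃ j : ℤ, ⇑(T ^ j) '' W := by
    have hpre : ∀ j : ℤ, ⇑T ⁻¹' (⇑(T ^ j) '' W) = ⇑(T ^ (j - 1)) '' W := fun j ↦ by
      have h := zpow_image_zpow_image T 1 (j - 1) W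
      rw [add_sub_cancel, zpow_one] at h
      rw [← h, Set.preimage_image_eq _ T.injective]
    simp_rw [Set.preimage_iUnion, hpre]
    exact (Equiv.subRight (1 : ℤ)).surjective.iUnion_comp fun j ↦ ⇑(T ^ j) '' W
  refine (hTerg _ (MeasurableSet.iUnion fun j ↦ hT.measurableSet_zpow_image j hW)
    (by simp [hinv])).resolve_left fun h0 ↦ hpos.ne' ?_
  exact measure_mono_null (by simpa using Set.subset_iUnion (fun j : ℤ ↦ ⇑(T ^ j) '' W) 0) h0

/-- Some finite union of translates of `W` has almost full measure, and it inherits the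
asymptotic vanishing from `W`. -/
theorem exists_tendsto_measure_zpow_image [IsProbabilityMeasure μ] (hT : Nonsingular μ T)
    (hTerg : ErgodicNS μ T) {W : Set X} (hW : MeasurableSet W) (hpos : 0 < μ W) {k : ℕ → ℕ}
    (hk : ∀ i j : ℕ, i ≠ j → μ (⇑(T ^ k i) '' W ∩ ⇑(T ^ k j) '' W) = 0)
    {ε : ℝ≥0∞} (hε : 0 < ε) :
    ∃ F : Set X, MeasurableSet F ∧ μ Fᶜ < ε ∧
      ∀ l : ℤ, Tendsto (fun i ↦ μ (⇑(T ^ (l + k i)) '' F)) atTop (nhds 0) := by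
  have hmeas : ∀ s : Finset ℤ, MeasurableSet (⋃ j ∈ s, ⇑(T ^ j) '' W) := fun s ↦
    s.measurableSet_biUnion fun j _ ↦ hT.measurableSet_zpow_image j hW
  obtain ⟨s, hs⟩ : ∃ s : Finset ℤ, μ (⋃ j ∈ s, ⇑(T ^ j) '' W)ᶜ < ε := by
    have hmono : Monotone fun s : Finset ℤ ↦ ⋃ j ∈ s, ⇑(T ^ j) '' W := fun s t hst ↦
      Set.biUnion_subset_biUnion_left hst
    have hlim := tendsto_measure_iInter_atTop (μ := μ)
      (fun s ↦ (hmeas s).compl.nullMeasurableSet) (fun s t hst ↦ Set.compl_subset_compl.2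
        (hmono hst)) ⟨∅, measure_ne_top _ _⟩
    have hzero : μ (⋂ s : Finset ℤ, (⋃ j ∈ s, ⇑(T ^ j) '' W)ᶜ) = 0 := by
      rw [← Set.compl_iUnion, ← Set.iUnion_eq_iUnion_finset,
        prob_compl_eq_zero_iff (MeasurableSet.iUnion fun j ↦ hT.measurableSet_zpow_image j hW)]
      exact hT.measure_iUnion_zpow_image_eq_one hTerg hW hpos
    rw [hzero] at hlim
    exact (hlim.eventually_lt_const hε).exists
  refine ⟨_, hmeas s, hs, fun l ↦ ?_⟩
  have hsum : Tendsto (fun i ↦ ∑ j ∈ s, μ (⇑(T ^ (l + j + k i)) '' W)) atTop (nhds 0) := by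
    simpa using tendsto_finsetSum s fun j _ ↦ hT.tendsto_measure_zpow_image hW hk (l + j)
  refine tendsto_of_tendsto_of_tendsto_of_le_of_le tendsto_const_nhds hsum
    (fun _ ↦ zero_le) fun i ↦ ?_
  change μ (⇑(T ^ (l + k i)) '' ⋃ j ∈ s, ⇑(T ^ j) '' W) ≤ _
  simp_rw [Set.image_iUnion, zpow_image_zpow_image, add_right_comm l _ (k i : ℤ)]
  exact measure_biUnion_finset_le _ _

/-- Along a sequence of times `n` at which the iterates become sufficiently singular, any sequence
of sets is asymptotically reached by the orbit of a single set. -/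
theorem exists_measure_zpow_image_symmDiff_le (hT : Nonsingular μ T) {n : ℕ → ℤ}
    {F U : ℕ → Set X} {e : ℕ → ℝ≥0∞} (hF : ∀ m, MeasurableSet (F m))
    (hU : ∀ m, MeasurableSet (U m)) (hFe : ∀ m, μ (F m)ᶜ ≤ e m)
    (hn : ∀ k m, k < m → μ (⇑(T ^ (n k - n m)) '' F m) ≤ e m) :
    ∃ A : Set X, MeasurableSet A ∧
      ∀ k, μ ((⇑(T ^ n k) '' A) ∆ U k) ≤ ∑' m, e (m + k) := by
  refine ⟨⋃ m, (⇑(T ^ (-n m)) '' (U m ∩ F m)) \ ⋃ j ∈ Set.Ioi m, ⇑(T ^ (-n j)) '' F j, ?_, ?_⟩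
  · exact MeasurableSet.iUnion fun m ↦
      (hT.measurableSet_zpow_image _ ((hU m).inter (hF m))).diff
        (MeasurableSet.biUnion (Set.to_countable _) fun j _ ↦
          hT.measurableSet_zpow_image _ (hF j))
  intro k
  set A := ⋃ m, (⇑(T ^ (-n m)) '' (U m ∩ F m)) \ ⋃ j ∈ Set.Ioi m, ⇑(T ^ (-n j)) '' F j with hA
  have hsub : (⇑(T ^ n k) '' A) ∆ U k ⊆
      (F k)ᶜ ∪ ⋃ m, ⇑(T ^ (n k - n (m + 1 + k))) '' F (m + 1 + k) := by
    intro y hy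
    by_contra hcon
    simp only [Set.mem_union, Set.mem_compl_iff, not_or, not_not, Set.mem_iUnion,
      not_exists] at hcon
    obtain ⟨hyF, hyG⟩ := hcon
    obtain ⟨x, rfl⟩ := (T ^ n k).surjective y
    have hxG : ∀ j, k < j → x ∉ ⇑(T ^ (-n j)) '' F j := fun j hj hx ↦ by
      obtain ⟨d, rfl⟩ := Nat.exists_eq_add_of_lt hj
      apply hyG d
      rw [show d + 1 + k = k + d + 1 by omega, sub_eq_add_neg, ← zpow_image_zpow_image]
      exact Set.mem_image_of_mem _ hx
    have hback : ∀ B : Set X, x ∈ ⇑(T ^ (-n k)) '' B ↔ (T ^ n k) x ∈ B := fun B ↦ by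
      rw [zpow_neg, Equiv.image_eq_preimage_symm]
      rfl
    have hiff : x ∈ A ↔ (T ^ n k) x ∈ U k := by
      simp only [hA, Set.mem_iUnion, Set.mem_sdiff, Set.mem_Ioi, not_exists]
      constructor
      · rintro ⟨m, hm, hlast⟩
        have hmk : m = k := by
          apply le_antisymm <;> by_contra! hlt
          · exact hxG m hlt (Set.image_mono Set.inter_subset_right hm)
          · exact hlast k hlt ((hback _).2 hyF)
        subst hmk
        exact ((hback _).1 hm).1
      · exact fun hx ↦ ⟨k, (hback _).2 ⟨hx, hyF⟩, hxG⟩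
    rw [Set.mem_symmDiff, (T ^ n k).injective.mem_set_image, hiff] at hy
    tauto
  calc μ ((⇑(T ^ n k) '' A) ∆ U k)
      ≤ μ (F k)ᶜ + ∑' m, μ (⇑(T ^ (n k - n (m + 1 + k))) '' F (m + 1 + k)) :=
        (measure_mono hsub).trans ((measure_union_le _ _).trans
          (by gcongr; exact measure_iUnion_le _))
    _ ≤ e (0 + k) + ∑' m, e (m + 1 + k) := by
        gcongr with m
        · simpa using hFe k
        · exact hn _ _ (by omega)
    _ = ∑' m, e (m + k) := (tsum_eq_zero_add' (f := fun m ↦ e (m + k)) ENNReal.summable).symm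

end Nonsingular

/-- A sequence of measurable sets in which every measurable set can be approximated infinitely
often. -/
theorem exists_seq_frequently_measure_symmDiff_lt {X : Type*} [MeasurableSpace X]
    (μ : Measure X) [IsFiniteMeasure μ] [IsSeparable μ] :
    ∃ U : ℕ → Set X, (∀ m, MeasurableSet (U m)) ∧
      ∀ V : Set X, MeasurableSet V → ∀ ε : ℝ≥0∞, 0 < ε →
        ∀ N, ∃ m, N ≤ m ∧ μ (U m ∆ V) < ε := by
  obtain ⟨𝒜, hcount, hdense⟩ := exists_countable_measureDense μ
  obtain ⟨g, rfl⟩ := hcount.exists_eq_range hdense.nonempty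
  refine ⟨fun m ↦ g m.unpair.1, fun m ↦ hdense.measurable _ ⟨_, rfl⟩, fun V hV ε hε N ↦ ?_⟩
  obtain ⟨δ, -, hδ, hδε⟩ := ENNReal.lt_iff_exists_real_btwn.1 hε
  obtain ⟨_, ⟨a, rfl⟩, ha⟩ :=
    hdense.approx V hV (measure_ne_top _ _) δ (ENNReal.ofReal_pos.1 hδ)
  exact ⟨Nat.pair a N, Nat.right_le_pair a N, by
    simpa [symmDiff_comm] using ha.trans hδε⟩

/-- **Krengel's theorem (existence of a transitive set).**  Let `T` be a nonsingular ergodic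
automorphism of a standard Borel probability space `(X, μ)` admitting a weakly wandering set
of positive measure.  Then there is a measurable set `A` whose `T`-orbit is dense in the
measure algebra: for every measurable `U` and every `ε > 0` there is `n ∈ ℤ` with
`μ(Tⁿ(A) Δ U) < ε`. -/
theorem krengel_transitive_set {X : Type*} [MeasurableSpace X] [StandardBorelSpace X]
    (μ : Measure X) [IsProbabilityMeasure μ] (T : Equiv.Perm X)
    (hT : Nonsingular μ T) (hTerg : ErgodicNS μ T)
    (hW : ∃ W : Set X, MeasurableSet W ∧ WeaklyWandering μ T W ∧ 0 < μ W) :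
    ∃ A : Set X, MeasurableSet A ∧
      ∀ U : Set X, MeasurableSet U → ∀ ε : ℝ≥0∞, 0 < ε →
        ∃ n : ℤ, μ ((⇑(T ^ n) '' A) ∆ U) < ε := by
  obtain ⟨W, hWm, ⟨k, -, -, hk⟩, hpos⟩ := hW
  let e : ℕ → ℝ≥0∞ := fun i ↦ 2⁻¹ ^ i
  have hepos : ∀ i, 0 < e i := fun i ↦ ENNReal.pow_pos (by simp) i
  have hanti : Antitone e := fun i j hij ↦ pow_le_pow_right_of_le_one' (by simp) hij
  choose F hFm hFe hFlim using fun i ↦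
    hT.exists_tendsto_measure_zpow_image hTerg hWm hpos hk (hepos i)
  obtain ⟨f, -, hf⟩ := exists_seq_of_forall_finset_exists (α := ℕ × ℤ) (fun _ ↦ True)
    (fun a b ↦ a.1 < b.1 ∧ μ (⇑(T ^ (a.2 - b.2)) '' F b.1) < e b.1) fun s _ ↦ by
      obtain ⟨i, hi⟩ : ∃ i, ∀ a ∈ s, a.1 < i :=
        ⟨s.sup Prod.fst + 1, fun a ha ↦ Nat.lt_succ_of_le (Finset.le_sup (f := Prod.fst) ha)⟩
      obtain ⟨j, hj⟩ := ((Filter.eventually_all_finset s).2 fun a _ ↦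
        (hFlim i a.2).eventually_lt_const (hepos i)).exists
      exact ⟨(i, -k j), trivial, fun a ha ↦ ⟨hi a ha, by simpa using hj a ha⟩⟩
  have hmono : StrictMono fun m ↦ (f m).1 := fun a b hab ↦ (hf a b hab).1
  have hle : ∀ m, e (f m).1 ≤ e m := fun m ↦ hanti (hmono.le_apply (x := m))
  obtain ⟨U, hUm, hU⟩ := exists_seq_frequently_measure_symmDiff_lt μ
  obtain ⟨A, hAm, hA⟩ := hT.exists_measure_zpow_image_symmDiff_le (n := fun m ↦ (f m).2)
    (F := fun m ↦ F (f m).1) (e := e) (fun m ↦ hFm _) hUm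
    (fun m ↦ (hFe _).le.trans (hle m)) fun a b hab ↦ (hf a b hab).2.le.trans (hle b)
  refine ⟨A, hAm, fun V hV ε hε ↦ ?_⟩
  have htail : Tendsto (fun i ↦ ∑' m, e (m + i)) atTop (nhds 0) :=
    ENNReal.tendsto_sum_nat_add e (by simp [e, ENNReal.tsum_geometric])
  have hε2 : 0 < ε / 2 := ENNReal.half_pos hε.ne'
  obtain ⟨N, hN⟩ := eventually_atTop.1 (htail.eventually_lt_const hε2)
  obtain ⟨m, hNm, hm⟩ := hU V hV (ε / 2) hε2 N
  refine ⟨(f m).2, ?_⟩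
  calc μ ((⇑(T ^ (f m).2) '' A) ∆ V)
      ≤ μ ((⇑(T ^ (f m).2) '' A) ∆ U m) + μ (U m ∆ V) := measure_symmDiff_le _ _ _
    _ < ε / 2 + ε / 2 := ENNReal.add_lt_add ((hA m).trans_lt (hN m hNm)) hm
    _ = ε := ENNReal.add_halves ε
end

section
/- Let Λ be a countable group with Λ ≠ {1}, and let μ be a probability measure on Sub(Λ) (with the σ-algebra generated by the sets {H : γ ∈ H}, γ ∈ Λ) such that each conjugation map H ↦ γHγ⁻¹ is nonsingular for μ. Then the conjugation action of Λ on (Sub(Λ), μ) is globally conservative: for every measurable set B ⊆ Sub(Λ) with μ(B) > 0 there exists γ ∈ Λ with γ ≠ 1 such that μ({H ∈ B : γ⁻¹Hγ ∈ B}) > 0, i.e., μ(γBγ⁻¹ ∩ B) > 0. -/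
open MeasureTheory

variable {Λ : Type*} [Group Λ]

/-- The σ-algebra on `Sub(Λ)` generated by the sets `{H : γ ∈ H}`, `γ ∈ Λ`. -/
instance subgroupMeasurableSpace : MeasurableSpace (Subgroup Λ) :=
  MeasurableSpace.generateFrom {S | ∃ γ : Λ, S = {H : Subgroup Λ | γ ∈ H}}

/-- The conjugation map `H ↦ γHγ⁻¹` on subgroups. -/
def conjSubgroup (γ : Λ) (H : Subgroup Λ) : Subgroup Λ :=
  H.map (MulAut.conj γ).toMonoidHom

theorem conjSubgroup_inv_eq_self {γ : Λ} {H : Subgroup Λ} (hγ : γ ∈ H) :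
    conjSubgroup γ⁻¹ H = H :=
  Subgroup.mem_normalizer_iff_map_conj_eq.mp (Subgroup.le_normalizer (inv_mem hγ))

theorem conjSubgroup_bot (γ : Λ) : conjSubgroup γ (⊥ : Subgroup Λ) = ⊥ :=
  Subgroup.map_bot _

theorem exists_ne_one_conjSubgroup_inv_eq_self [Nontrivial Λ] (H : Subgroup Λ) :
    ∃ γ : Λ, γ ≠ 1 ∧ conjSubgroup γ⁻¹ H = H := by
  rcases H.bot_or_exists_ne_one with rfl | ⟨γ, hγ, hne⟩
  · obtain ⟨γ, hne⟩ := exists_ne (1 : Λ)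
    exact ⟨γ, hne, conjSubgroup_bot _⟩
  · exact ⟨γ, hne, conjSubgroup_inv_eq_self hγ⟩

/-- **Global conservativity of nonsingular random subgroups.**  Let `Λ` be a countable
nontrivial group and `μ` a probability measure on `Sub(Λ)` such that each conjugation map
`H ↦ γHγ⁻¹` is nonsingular for `μ`.  Then the conjugation action is globally conservative:
for every measurable `B` of positive measure there exists `γ ≠ 1` with
`μ({H ∈ B : γ⁻¹Hγ ∈ B}) > 0`. -/
theorem globally_conservative [Countable Λ] [Nontrivial Λ]
    (μ : Measure (Subgroup Λ)) [IsProbabilityMeasure μ]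
    (hns : ∀ γ : Λ, ∀ B : Set (Subgroup Λ), MeasurableSet B →
      (μ (conjSubgroup γ ⁻¹' B) = 0 ↔ μ B = 0)) :
    ∀ B : Set (Subgroup Λ), MeasurableSet B → 0 < μ B →
      ∃ γ : Λ, γ ≠ 1 ∧ 0 < μ {H | H ∈ B ∧ conjSubgroup γ⁻¹ H ∈ B} := by
  intro B _ hB
  by_contra! h
  have hnull : μ (⋃ γ : {γ : Λ // γ ≠ 1}, {H | H ∈ B ∧ conjSubgroup (γ : Λ)⁻¹ H ∈ B}) = 0 :=
    measure_iUnion_null fun γ => nonpos_iff_eq_zero.mp (h γ γ.2)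
  refine hB.ne' (measure_mono_null (fun H hH => ?_) hnull)
  obtain ⟨γ, hne, hγ⟩ := exists_ne_one_conjSubgroup_inv_eq_self H
  exact Set.mem_iUnion.mpr ⟨⟨γ, hne⟩, hH, hγ.symm ▸ hH⟩
end

section
/- For every k ∈ ℕ, the union ⋃_{k' ≥ k} C_{Sym(ℤ)}(σ^{k'}) of the centralizers in Sym(ℤ) of the powers σ^{k'} with k' ≥ k is dense in Sym(ℤ). Moreover, for every k ∈ ℕ, the set {ρ ∈ Hom_σ(Γ, Sym(ℤ)) : there exists n ≥ k with ρ(Γ) ⊆ C_{Sym(ℤ)}(σⁿ)} is dense in Hom_σ(Γ, Sym(ℤ)). -/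
open Filter Set

/-- Pointwise-convergence topology on `Sym(ℤ)` (with `ℤ` discrete). -/
instance permIntTopology : TopologicalSpace (Equiv.Perm ℤ) :=
  TopologicalSpace.induced (fun g : Equiv.Perm ℤ => (g : ℤ → ℤ)) inferInstance

/-- The shift `σ : n ↦ n + 1`. -/
def shiftPerm : Equiv.Perm ℤ := Equiv.addRight 1

/-- Pointwise-convergence topology on the space of homomorphisms `Γ → Sym(ℤ)`. -/
instance homTopology {ι : Type*} : TopologicalSpace (FreeGroup ι →* Equiv.Perm ℤ) :=
  TopologicalSpace.induced (fun ρ => (ρ : FreeGroup ι → Equiv.Perm ℤ)) inferInstance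

/-- `Hom_σ(Γ, Sym(ℤ))`: homomorphisms sending the distinguished free generator `a₀` to the
shift `σ`, with the subspace (= pointwise convergence) topology. -/
abbrev HomSigma {ι : Type*} (a₀ : ι) : Type _ :=
  {ρ : FreeGroup ι →* Equiv.Perm ℤ // ρ (FreeGroup.of a₀) = shiftPerm}

open Topology

/-- The identification of `ℤ` with `ℤ × Fin n` coming from division with remainder by `n`,
with the remainders taken in the window `[-(n / 2), n - n / 2)`. -/
def centeredDivMod (n : ℕ) [NeZero n] : ℤ ≃ ℤ × Fin n :=
  (Equiv.addRight ((n / 2 : ℕ) : ℤ)).trans (Int.divModEquiv n)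

lemma centeredDivMod_symm_apply (n : ℕ) [NeZero n] (p : ℤ × Fin n) :
    (centeredDivMod n).symm p = p.1 * n + (p.2 : ℕ) - (n / 2 : ℕ) := by
  simp [centeredDivMod, Int.divModEquiv, sub_eq_add_neg]

lemma centeredDivMod_fst_eq_zero (n : ℕ) [NeZero n] {x : ℤ} (hx : 2 * |x| < n) :
    (centeredDivMod n x).1 = 0 := by
  have h : (centeredDivMod n x).1 = (x + (n / 2 : ℕ)) / n := rfl
  rw [h]
  have := abs_lt.1 (show |x| < |x| + 1 by omega)
  exact Int.ediv_eq_zero_of_lt (by omega) (by omega)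

lemma shiftPerm_pow_apply (n : ℕ) (x : ℤ) : (shiftPerm ^ n) x = x + n := by
  simp [shiftPerm]

lemma centeredDivMod_add (n : ℕ) [NeZero n] (x : ℤ) :
    centeredDivMod n (x + n) = ((centeredDivMod n x).1 + 1, (centeredDivMod n x).2) := by
  rw [← Equiv.eq_symm_apply, centeredDivMod_symm_apply]
  have h := centeredDivMod_symm_apply n (centeredDivMod n x)
  rw [Equiv.symm_apply_apply] at h
  linarith

/-- A permutation of `ℤ` agrees on the window of radius `n / 2` with a permutation commuting
with `σⁿ`, as far as it preserves that window. -/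
lemma exists_commute_shiftPerm_pow (g : Equiv.Perm ℤ) (n : ℕ) :
    ∃ h : Equiv.Perm ℤ, Commute h (shiftPerm ^ n) ∧
      ∀ x : ℤ, 2 * |x| < n → 2 * |g x| < n → h x = g x := by
  rcases Nat.eq_zero_or_pos n with rfl | hn
  · exact ⟨g, by simp, fun _ _ _ => rfl⟩
  have : NeZero n := ⟨hn.ne'⟩
  set c := centeredDivMod n with hc
  let f : Fin n → Fin n := fun i => (c (g (c.symm (0, i)))).2
  let s : Finset (Fin n) := {i | (c (g (c.symm (0, i)))).1 = 0}
  have hf : Set.InjOn f s := by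
    intro i hi j hj hij
    have hi' : (c (g (c.symm (0, i)))).1 = 0 := by simpa [s] using hi
    have hj' : (c (g (c.symm (0, j)))).1 = 0 := by simpa [s] using hj
    have := c.injective (Prod.ext (hi'.trans hj'.symm) hij)
    simpa using this
  obtain ⟨e, he⟩ := Finset.exists_equiv_extend_of_card_eq (t := Finset.univ) (by simp)
    (Finset.subset_univ _) hf
  let π : Equiv.Perm (Fin n) := e.trans (Equiv.subtypeUnivEquiv (by simp))
  have hπ : ∀ i ∈ s, π i = f i := he
  refine ⟨c.trans (((Equiv.refl ℤ).prodCongr π).trans c.symm), ?_, fun x hx hgx => ?_⟩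
  · ext x
    simp only [Equiv.Perm.mul_apply, shiftPerm_pow_apply, Equiv.trans_apply, hc,
      centeredDivMod_add, Equiv.prodCongr_apply, Prod.map, Equiv.refl_apply,
      centeredDivMod_symm_apply]
    ring
  · have hx0 : c x = (0, (c x).2) := Prod.ext (centeredDivMod_fst_eq_zero n hx) rfl
    have hgx0 : (c (g x)).1 = 0 := centeredDivMod_fst_eq_zero n hgx
    have hcx : c.symm (0, (c x).2) = x := by rw [← hx0, Equiv.symm_apply_apply]
    have hmem : (c x).2 ∈ s := by simp [s, hcx, hgx0]
    have hval : π (c x).2 = (c (g x)).2 := by rw [hπ _ hmem]; simp only [f, hcx]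
    rw [Equiv.trans_apply, Equiv.trans_apply, Equiv.symm_apply_eq, hx0]
    exact Prod.ext hgx0.symm hval

/-- Every permutation of `ℤ` is a pointwise limit of permutations `h n` commuting with `σⁿ`. -/
lemma exists_seq_commute_shiftPerm_pow (g : Equiv.Perm ℤ) :
    ∃ h : ℕ → Equiv.Perm ℤ, (∀ n, Commute (h n) (shiftPerm ^ n)) ∧
      ∀ x, ∀ᶠ n in atTop, h n x = g x := by
  choose h hcomm heq using exists_commute_shiftPerm_pow g
  refine ⟨h, hcomm, fun x => ?_⟩
  filter_upwards [eventually_gt_atTop (2 * |x|).toNat, eventually_gt_atTop (2 * |g x|).toNat]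
    with n hx hgx
  exact heq n x (by omega) (by omega)

lemma tendsto_perm_int_iff {α : Type*} {l : Filter α} {h : α → Equiv.Perm ℤ}
    {g : Equiv.Perm ℤ} : Tendsto h l (𝓝 g) ↔ ∀ x, ∀ᶠ a in l, h a x = g x := by
  have hind : IsInducing (fun g : Equiv.Perm ℤ => (g : ℤ → ℤ)) := ⟨rfl⟩
  simp [hind.tendsto_nhds_iff, tendsto_pi_nhds, nhds_discrete, tendsto_pure]

lemma tendsto_homSigma_iff {ι α : Type*} {a₀ : ι} {l : Filter α} {r : α → HomSigma a₀}
    {ρ : HomSigma a₀} : Tendsto r l (𝓝 ρ) ↔ ∀ γ, Tendsto (fun a => (r a).1 γ) l (𝓝 (ρ.1 γ)) := by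
  have hind : IsInducing
      (fun ρ : FreeGroup ι →* Equiv.Perm ℤ => (ρ : FreeGroup ι → Equiv.Perm ℤ)) := ⟨rfl⟩
  rw [tendsto_subtype_rng, hind.tendsto_nhds_iff, tendsto_pi_nhds]
  rfl

/-- Pointwise convergence of homomorphisms from a free group can be checked on the basis. -/
lemma eventually_freeGroup_hom_apply_eq {ι α : Type*} {l : Filter α}
    {r : α → FreeGroup ι →* Equiv.Perm ℤ} {ρ : FreeGroup ι →* Equiv.Perm ℤ}
    (h : ∀ i x, ∀ᶠ a in l, r a (FreeGroup.of i) x = ρ (FreeGroup.of i) x) (γ : FreeGroup ι) :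
    ∀ x, ∀ᶠ a in l, r a γ x = ρ γ x := by
  induction γ using FreeGroup.induction_on with
  | C1 => simp
  | of i => exact h i
  | inv_of i ih =>
    intro x
    filter_upwards [ih ((ρ (FreeGroup.of i))⁻¹ x)] with a ha
    rw [map_inv, map_inv, Equiv.Perm.inv_eq_iff_eq]
    simpa using ha.symm
  | mul γ δ ihγ ihδ =>
    intro x
    filter_upwards [ihδ x, ihγ (ρ δ x)] with a hδ hγ
    rw [map_mul, map_mul, Equiv.Perm.mul_apply, Equiv.Perm.mul_apply, hδ, hγ]

/-- **Density of centralizers of large powers of the shift.**  For every `k ∈ ℕ`, the union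
`⋃_{k' ≥ k} C_{Sym(ℤ)}(σ^{k'})` is dense in `Sym(ℤ)`; moreover, for the free group `Γ` with
basis `(a₀, b₁, b₂, …)` the set of constrained representations `ρ ∈ Hom_σ(Γ, Sym(ℤ))` whose
image lies in the centralizer of `σⁿ` for some `n ≥ k` is dense in `Hom_σ(Γ, Sym(ℤ))`. -/
theorem centralizers_dense {ι : Type*} [Countable ι] [Nontrivial ι] (a₀ : ι) (k : ℕ) :
    Dense (⋃ k' ∈ Set.Ici k, {h : Equiv.Perm ℤ | Commute h (shiftPerm ^ k')}) ∧
    Dense {ρ : HomSigma a₀ |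
      ∃ n : ℕ, k ≤ n ∧ ∀ γ : FreeGroup ι, Commute (ρ.1 γ) (shiftPerm ^ n)} := by
  classical
  refine ⟨fun g => ?_, fun ρ => ?_⟩
  · obtain ⟨h, hcomm, hlim⟩ := exists_seq_commute_shiftPerm_pow g
    refine mem_closure_of_tendsto (tendsto_perm_int_iff.2 hlim) ?_
    filter_upwards [eventually_ge_atTop k] with n hn
    exact mem_biUnion (mem_Ici.2 hn) (hcomm n)
  · choose h hcomm hlim using
      fun i => exists_seq_commute_shiftPerm_pow (ρ.1 (FreeGroup.of i))
    let b : ℕ → ι → Equiv.Perm ℤ := fun n i => if i = a₀ then shiftPerm else h i n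
    have hb : ∀ n i, Commute (b n i) (shiftPerm ^ n) := by
      intro n i
      by_cases hi : i = a₀
      · simp [b, hi]
      · simpa [b, hi] using hcomm i n
    let r : ℕ → HomSigma a₀ := fun n => ⟨FreeGroup.lift (b n), by simp [b]⟩
    have hr : ∀ i x, ∀ᶠ n in atTop, (r n).1 (FreeGroup.of i) x = ρ.1 (FreeGroup.of i) x := by
      intro i x
      by_cases hi : i = a₀
      · simp [r, b, hi, ρ.2]
      · simpa [r, b, hi] using hlim i x
    refine mem_closure_of_tendsto (tendsto_homSigma_iff.2 fun γ =>
      tendsto_perm_int_iff.2 (eventually_freeGroup_hom_apply_eq hr γ)) ?_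
    filter_upwards [eventually_ge_atTop k] with n hn
    refine ⟨n, hn, fun γ => ?_⟩
    induction γ using FreeGroup.induction_on with
    | C1 => simp
    | of i => simpa [r] using hb n i
    | inv_of i ih => simpa only [map_inv] using ih.inv_left
    | mul γ δ ihγ ihδ => simpa only [map_mul] using ihγ.mul_left ihδ
end

section
/- For a generic ρ ∈ Hom_σ(Γ, Sym(ℤ)) the following holds: for every w ∈ Γ, every orbit of the permutation ρ(w) on ℤ is finite if and only if w is not of the form u a^k u⁻¹ for some u ∈ Γ and some k ∈ ℤ with k ≠ 0. -/
open Filter Set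

/-- The `⟨g⟩`-orbit of a point `x`. -/
def zOrbit {X : Type*} (g : Equiv.Perm X) (x : X) : Set X :=
  Set.range fun n : ℤ => (g ^ n) x

/-- The inverse of a letter `b_i^{±1}`. -/
def letterInv {J : Type*} (c : J × Bool) : J × Bool := (c.1, !c.2)

/-- The labelled edge traversed when the letter `c` moves `u` to `v`. -/
def letterEdge {J : Type*} (c : J × Bool) (u v : ℤ) : J × ℤ × ℤ :=
  if c.2 then (c.1, u, v) else (c.1, v, u)

/-- A set of labelled edges in which every letter acts as a partial injection. -/
def IsPartialInj {J : Type*} (E : Finset (J × ℤ × ℤ)) : Prop :=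
  ∀ c u v v', letterEdge c u v ∈ E → letterEdge c u v' ∈ E → v = v'

/-- `p` follows the syllables `s j = (k, c)` (shift by `k`, then apply `c`) along edges of `E`
for the times `A ≤ j < B`. -/
def IsPathOn {J : Type*} (E : Finset (J × ℤ × ℤ)) (s : ℤ → ℤ × J × Bool) (p : ℤ → ℤ)
    (A B : ℤ) : Prop :=
  ∀ j, A ≤ j → j < B → letterEdge (s j).2 (p j + (s j).1) (p (j + 1)) ∈ E

/-- `E` extends to a finite partial action in which the path along `s` through `x` closes up
after a multiple of `m` syllables. -/
def IsClosable {J : Type*} (E : Finset (J × ℤ × ℤ)) (s : ℤ → ℤ × J × Bool) (m x : ℤ) : Prop :=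
  ∃ E', E ⊆ E' ∧ IsPartialInj E' ∧ ∃ (q : ℤ → ℤ) (T : ℤ), 0 < T ∧ m ∣ T ∧
    (∀ j, letterEdge (s j).2 (q j + (s j).1) (q (j + 1)) ∈ E') ∧ q 0 = x ∧ q T = x

/-- A path around time `0` which can be prolonged neither forwards nor backwards inside `E`. -/
structure IsMaximalPath {J : Type*} (E : Finset (J × ℤ × ℤ)) (s : ℤ → ℤ × J × Bool)
    (p : ℤ → ℤ) (A B : ℤ) : Prop where
  inj : IsPartialInj E
  nonpos : A ≤ 0
  nonneg : 0 ≤ B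
  path : IsPathOn E s p A B
  fwd : ∀ v, letterEdge (s B).2 (p B + (s B).1) v ∉ E
  bwd : ∀ u, letterEdge (s (A - 1)).2 u (p A) ∉ E

section PartialActions

variable {J : Type*} {E E' : Finset (J × ℤ × ℤ)} {s : ℤ → ℤ × J × Bool} {p : ℤ → ℤ}
  {A B m x : ℤ}

theorem letterInv_letterInv (c : J × Bool) : letterInv (letterInv c) = c := by
  simp [letterInv]

theorem letterInv_ne (c : J × Bool) : letterInv c ≠ c := by
  rcases c with ⟨i, _ | _⟩ <;> simp [letterInv]

theorem letterEdge_letterInv (c : J × Bool) (u v : ℤ) :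
    letterEdge (letterInv c) u v = letterEdge c v u := by
  rcases c with ⟨i, _ | _⟩ <;> simp [letterInv, letterEdge]

theorem letterEdge_eq_iff {c d : J × Bool} {u v y z : ℤ} :
    letterEdge d u v = letterEdge c y z ↔
      (d = c ∧ u = y ∧ v = z) ∨ (d = letterInv c ∧ u = z ∧ v = y) := by
  rcases c with ⟨i, _ | _⟩ <;> rcases d with ⟨j, _ | _⟩ <;>
    simp [letterInv, letterEdge] <;> tauto

theorem IsPartialInj.insert [DecidableEq J] (hE : IsPartialInj E) {c : J × Bool} {y z : ℤ}
    (hy : ∀ v, letterEdge c y v ∉ E) (hz : ∀ u, letterEdge c u z ∉ E) :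
    IsPartialInj (insert (letterEdge c y z) E) := by
  intro d u v v' h h'
  rw [Finset.mem_insert, letterEdge_eq_iff] at h h'
  have key : ∀ v, letterEdge d u v ∈ E →
      ¬ ((d = c ∧ u = y) ∨ (d = letterInv c ∧ u = z)) := by
    rintro v hv (⟨rfl, rfl⟩ | ⟨rfl, rfl⟩)
    · exact hy _ hv
    · rw [letterEdge_letterInv] at hv
      exact hz _ hv
  have hc := letterInv_ne c
  rcases h with (⟨h1, h2, h3⟩ | ⟨h1, h2, h3⟩) | h <;>
    rcases h' with (⟨h1', h2', h3'⟩ | ⟨h1', h2', h3'⟩) | h'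
  · rw [h3, h3']
  · exact absurd (h1'.symm.trans h1) hc
  · exact absurd (Or.inl ⟨h1, h2⟩) (key _ h')
  · exact absurd (h1.symm.trans h1') hc
  · rw [h3, h3']
  · exact absurd (Or.inr ⟨h1, h2⟩) (key _ h')
  · exact absurd (Or.inl ⟨h1', h2'⟩) (key _ h)
  · exact absurd (Or.inr ⟨h1', h2'⟩) (key _ h)
  · exact hE _ _ _ _ h h'

theorem IsPathOn.mono (hp : IsPathOn E s p A B) (h : E ⊆ E') : IsPathOn E' s p A B :=
  fun j h1 h2 => h (hp j h1 h2)

theorem IsClosable.mono (h : E ⊆ E') (hc : IsClosable E' s m x) : IsClosable E s m x := by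
  obtain ⟨E'', h1, h2⟩ := hc
  exact ⟨E'', h.trans h1, h2⟩

/-- Paths are determined by any one of their points. -/
theorem IsPathOn.unique (hE : IsPartialInj E) (hp : IsPathOn E s p A B) {q : ℤ → ℤ}
    (hq : IsPathOn E s q A B) {t : ℤ} (ht : p t = q t) (hAt : A ≤ t) (htB : t ≤ B) {j : ℤ}
    (hAj : A ≤ j) (hjB : j ≤ B) : p j = q j := by
  rcases le_total t j with h | h
  · induction j, h using Int.leInduction with
    | base => exact ht
    | succ n hn ih =>
      have h1 := hp n (by lia) (by lia)
      have h2 := hq n (by lia) (by lia)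
      rw [ih (by lia) (by lia)] at h1
      exact hE _ _ _ _ h1 h2
  · induction j, h using Int.leInductionDown with
    | base => exact ht
    | pred n hn ih =>
      have h1 := hp (n - 1) (by lia) (by lia)
      have h2 := hq (n - 1) (by lia) (by lia)
      rw [sub_add_cancel, ← letterEdge_letterInv] at h1 h2
      rw [ih (by lia) (by lia)] at h1
      have := hE _ _ _ _ h1 h2
      lia

theorem periodic_of_dvd (hs : ∀ j, s (j + m) = s j) {j j' : ℤ} (h : m ∣ j' - j) :
    s j' = s j := by
  obtain ⟨n, hn⟩ := h
  have : j' = j + n * m := by lia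
  rw [this]
  exact (Function.Periodic.int_mul hs n) j

theorem emod_add_one_cases {T : ℤ} (hT : 0 < T) (a : ℤ) :
    (a + 1) % T = a % T + 1 ∨ ((a + 1) % T = 0 ∧ a % T + 1 = T) := by
  have h1 := Int.emod_nonneg a hT.ne'
  have h2 := Int.emod_lt_of_pos a hT
  have h3 : (a + 1) % T = (a % T + 1) % T := by simp
  rcases (by lia : a % T + 1 < T ∨ a % T + 1 = T) with h | h
  · left
    rw [h3, Int.emod_eq_of_lt (by lia) h]
  · right
    rw [h3, h]
    simp

/-- A path which revisits a point after a multiple of the period closes up. -/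
theorem IsPathOn.isClosable (hE : IsPartialInj E) (hs : ∀ j, s (j + m) = s j)
    (hp : IsPathOn E s p A B) (hA : A ≤ 0) (hB : 0 ≤ B) {t T : ℤ} (hT : 0 < T) (hmT : m ∣ T)
    (hAt : A ≤ t) (htB : t + T ≤ B) (h : p (t + T) = p t) : IsClosable E s m (p 0) := by
  have hpath : ∀ j, letterEdge (s j).2 (p (t + (j - t) % T) + (s j).1)
      (p (t + (j + 1 - t) % T)) ∈ E := by
    intro j
    have h1 := Int.emod_nonneg (j - t) hT.ne'
    have h2 := Int.emod_lt_of_pos (j - t) hT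
    have hsj : s j = s (t + (j - t) % T) := by
      apply periodic_of_dvd hs
      have : j - (t + (j - t) % T) = T * ((j - t) / T) := by
        have := Int.emod_add_mul_ediv (j - t) T
        lia
      rw [this]
      exact hmT.mul_right _
    have := hp (t + (j - t) % T) (by lia) (by lia)
    rw [hsj]
    have e : j + 1 - t = j - t + 1 := by ring
    rw [e]
    rcases emod_add_one_cases hT (j - t) with h3 | ⟨h3, h4⟩
    · rwa [h3, ← add_assoc]
    · rw [add_assoc, h4, h] at this
      rwa [h3, add_zero]
  have hq0 : p 0 = p (t + (0 - t) % T) :=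
    hp.unique (q := fun j => p (t + (j - t) % T)) hE (fun j _ _ => hpath j) (t := t)
      (by simp) hAt (by lia) hA hB
  refine ⟨E, subset_rfl, hE, fun j => p (t + (j - t) % T), T, hT, hmT, hpath, hq0.symm, ?_⟩
  have e : T - t = 0 - t + T := by ring
  simp only [e, Int.add_emod_right]
  exact hq0.symm

theorem IsPathOn.isClosable_of_long (hE : IsPartialInj E) (hs : ∀ j, s (j + m) = s j)
    (hm : 0 < m) (hp : IsPathOn E s p A B) (hA : A ≤ 0) (hB : 0 ≤ B)
    (hlong : A + m * E.card < B) : IsClosable E s m (p 0) := by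
  classical
  let f : ℕ → J × ℤ × ℤ := fun n =>
    letterEdge (s A).2 (p (A + m * n) + (s A).1) (p (A + m * n + 1))
  have hf : ∀ n ∈ Finset.range (E.card + 1), f n ∈ E := by
    intro n hn
    have hn' : (n : ℤ) ≤ E.card := by
      have := Finset.mem_range.1 hn
      lia
    have h1 : m * (n : ℤ) ≤ m * E.card := mul_le_mul_of_nonneg_left hn' hm.le
    have h2 : 0 ≤ m * (n : ℤ) := by positivity
    have := hp (A + m * n) (by lia) (by lia)
    rwa [periodic_of_dvd hs (j := A) (j' := A + m * n) (by simp)] at this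
  obtain ⟨n, hn, n', hn', hne, heq⟩ :=
    Finset.exists_ne_map_eq_of_card_lt_of_maps_to (by simp) hf
  wlog hlt : n < n' generalizing n n'
  · exact this n' hn' n hn hne.symm heq.symm (by lia)
  have hpp : p (A + m * n) = p (A + m * n') := by
    rcases letterEdge_eq_iff.1 heq with h | h
    · lia
    · exact absurd h.1.symm (letterInv_ne _)
  have hn'' : (n' : ℤ) ≤ E.card := by
    have := Finset.mem_range.1 hn'
    lia
  have h1 : m * (n' : ℤ) ≤ m * E.card := mul_le_mul_of_nonneg_left hn'' hm.le
  have h2 : 0 ≤ m * (n : ℤ) := by positivity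
  have e : A + m * n + m * ((n' : ℤ) - n) = A + m * n' := by ring
  refine hp.isClosable hE hs hA hB (t := A + m * n) (T := m * ((n' : ℤ) - n)) ?_
    (dvd_mul_right _ _) (by lia) (by lia) (by rw [e, hpp])
  have : (0 : ℤ) < (n' : ℤ) - n := by lia
  positivity

theorem exists_isMaximalPath (hE : IsPartialInj E) (hs : ∀ j, s (j + m) = s j) (hm : 0 < m)
    (hA : A ≤ 0) (hB : 0 ≤ B) (hp : IsPathOn E s p A B) :
    IsClosable E s m (p 0) ∨ ∃ q A' B', IsMaximalPath E s q A' B' ∧ q 0 = p 0 := by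
  obtain ⟨d, hd⟩ : ∃ d : ℕ, A + m * E.card < B + d :=
    ⟨(A + m * E.card - B + 1).toNat, by lia⟩
  induction d generalizing A B p with
  | zero => exact Or.inl (hp.isClosable_of_long hE hs hm hA hB (by simpa using hd))
  | succ d ih =>
    by_cases hf : ∃ v, letterEdge (s B).2 (p B + (s B).1) v ∈ E
    · obtain ⟨v, hv⟩ := hf
      have hpath : IsPathOn E s (Function.update p (B + 1) v) A (B + 1) := by
        intro j h1 h2
        rw [Function.update_of_ne (by lia)]
        rcases (by lia : j < B ∨ j = B) with h | rfl
        · rw [Function.update_of_ne (by lia)]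
          exact hp j h1 h
        · simpa using hv
      have := ih hA (by lia) hpath (by push_cast at hd; lia)
      rwa [Function.update_of_ne (by lia)] at this
    · by_cases hb : ∃ u, letterEdge (s (A - 1)).2 u (p A) ∈ E
      · obtain ⟨u, hu⟩ := hb
        have hpath : IsPathOn E s (Function.update p (A - 1) (u - (s (A - 1)).1)) (A - 1) B := by
          intro j h1 h2
          rw [Function.update_of_ne (a := j + 1) (by lia)]
          rcases (by lia : A ≤ j ∨ j = A - 1) with h | rfl
          · rw [Function.update_of_ne (by lia)]
            exact hp j h h2
          · simpa using hu
        have := ih (by lia) hB hpath (by push_cast at hd; lia)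
        rwa [Function.update_of_ne (by lia)] at this
      · push Not at hf hb
        exact Or.inr ⟨p, A, B, ⟨hE, hA, hB, hp, hf, hb⟩, rfl⟩

theorem exists_fresh (E : Finset (J × ℤ × ℤ)) (V K : Finset ℤ) :
    ∃ N : ℤ, ∀ k ∈ K, N + k ∉ V ∧ ∀ c v, letterEdge c (N + k) v ∉ E := by
  classical
  let V' := V ∪ E.image (fun e => e.2.1) ∪ E.image (fun e => e.2.2)
  obtain ⟨N, hN⟩ := Infinite.exists_notMem_finset
    ((V' ×ˢ K).image fun a => a.1 - a.2)
  refine ⟨N, fun k hk => ?_⟩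
  have h : N + k ∉ V' := fun h =>
    hN (Finset.mem_image.2 ⟨(N + k, k), Finset.mem_product.2 ⟨h, hk⟩, by simp⟩)
  simp only [V', Finset.mem_union, Finset.mem_image, not_or, not_exists, not_and] at h
  refine ⟨h.1.1, ?_⟩
  rintro ⟨i, _ | _⟩ v hv
  · exact h.2 _ hv rfl
  · exact h.1.2 _ hv rfl

/-- If the two ends of a maximal path do not ask for the same edge, the path can be closed. -/
theorem IsMaximalPath.isClosable (hs : ∀ j, s (j + m) = s j) (hm : 0 < m)
    (hred : ∀ j, (s (j + 1)).1 = 0 → (s (j + 1)).2 ≠ letterInv (s j).2)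
    (h : IsMaximalPath E s p A B)
    (hne : ¬ (p B + (s B).1 = p A ∧ (s B).2 = letterInv (s (A - 1)).2)) :
    IsClosable E s m (p 0) := by
  classical
  obtain ⟨d, hd⟩ : ∃ d : ℕ, m ∣ B + d + 1 - A :=
    ⟨((A - 1 - B) % m).toNat, by
      rw [Int.toNat_of_nonneg (Int.emod_nonneg _ hm.ne')]
      have := Int.emod_add_mul_ediv (A - 1 - B) m
      exact ⟨-((A - 1 - B) / m), by lia⟩⟩
  induction d generalizing E p B with
  | zero =>
    have hsB : s B = s (A - 1) := periodic_of_dvd hs (by convert hd using 1; push_cast; ring)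
    have hsub := Finset.subset_insert (letterEdge (s B).2 (p B + (s B).1) (p A)) E
    have hE' : IsPartialInj (insert (letterEdge (s B).2 (p B + (s B).1) (p A)) E) :=
      h.inj.insert h.fwd (by rw [hsB]; exact h.bwd)
    have h0 := h.nonneg
    have h0' := h.nonpos
    have hpath : IsPathOn (insert (letterEdge (s B).2 (p B + (s B).1) (p A)) E) s
        (Function.update p (B + 1) (p A)) A (B + 1) := by
      intro j h1 h2
      rw [Function.update_of_ne (by lia)]
      rcases (by lia : j < B ∨ j = B) with h3 | rfl
      · rw [Function.update_of_ne (by lia)]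
        exact hsub (h.path j h1 h3)
      · simp
    have := hpath.isClosable (t := A) (T := B + 1 - A) hE' hs h.nonpos (by lia) (by lia)
      (by simpa using hd) le_rfl (by lia) (by
        rw [add_sub_cancel, Function.update_self, Function.update_of_ne (by lia)])
    rw [Function.update_of_ne (by lia)] at this
    exact this.mono hsub
  | succ d ih =>
    have h0 := h.nonneg
    have h0' := h.nonpos
    obtain ⟨N, hN⟩ := exists_fresh E {p A, p B + (s B).1} {0, (s (B + 1)).1}
    obtain ⟨hN1, hN2⟩ := hN 0 (by simp)
    obtain ⟨hN3, hN4⟩ := hN (s (B + 1)).1 (by simp)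
    simp only [add_zero, Finset.mem_insert, Finset.mem_singleton, not_or] at hN1 hN2 hN3
    have hsub := Finset.subset_insert (letterEdge (s B).2 (p B + (s B).1) N) E
    have hmax : IsMaximalPath (insert (letterEdge (s B).2 (p B + (s B).1) N) E) s
        (Function.update p (B + 1) N) A (B + 1) := by
      refine ⟨h.inj.insert h.fwd fun u => ?_, h.nonpos, by lia, ?_, ?_, ?_⟩
      · rw [← letterEdge_letterInv]
        exact hN2 _ _
      · intro j h1 h2
        rw [Function.update_of_ne (by lia)]
        rcases (by lia : j < B ∨ j = B) with h3 | rfl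
        · rw [Function.update_of_ne (by lia)]
          exact hsub (h.path j h1 h3)
        · simp
      · intro v
        rw [Function.update_self, Finset.mem_insert, letterEdge_eq_iff, not_or]
        refine ⟨?_, hN4 _ _⟩
        rintro (⟨_, h1, _⟩ | ⟨h1, h2, _⟩)
        · exact hN3.2 h1
        · exact hred B (by lia) h1
      · intro u
        rw [Function.update_of_ne (by lia), Finset.mem_insert, letterEdge_eq_iff, not_or]
        refine ⟨?_, h.bwd u⟩
        rintro (⟨_, _, h1⟩ | ⟨h1, _, h2⟩)
        · exact hN1.1 h1.symm
        · exact hne ⟨h2.symm, by rw [h1, letterInv_letterInv]⟩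
    have := ih hmax (by
      rw [Function.update_self, Function.update_of_ne (by lia)]
      exact fun h => hN3.1 h.1) (by convert hd using 1; push_cast; ring)
    rw [Function.update_of_ne (by lia)] at this
    exact this.mono hsub

/-- A periodic reduced sequence of syllables is not its own inverse. -/
theorem not_symmetric_of_reduced (hs : ∀ j, s (j + m) = s j) (hm : 0 < m)
    (hred : ∀ j, (s (j + 1)).1 = 0 → (s (j + 1)).2 ≠ letterInv (s j).2)
    (hsymm : ∀ i, 1 ≤ i → i ≤ m → (s (B - i)).2 = letterInv (s (A - 1 + i)).2 ∧
      (s (B - i + 1)).1 = -(s (A - 1 + i)).1) : False := by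
  have key : ∀ i, (s (B - i)).2 = letterInv (s (A - 1 + i)).2 ∧
      (s (B - i + 1)).1 = -(s (A - 1 + i)).1 := by
    intro i
    have h1 := Int.emod_nonneg (i - 1) hm.ne'
    have h2 := Int.emod_lt_of_pos (i - 1) hm
    have h3 := Int.emod_add_mul_ediv (i - 1) m
    have := hsymm ((i - 1) % m + 1) (by lia) (by lia)
    rwa [← periodic_of_dvd hs (j := B - ((i - 1) % m + 1)) (j' := B - i)
        ⟨-((i - 1) / m), by lia⟩,
      ← periodic_of_dvd hs (j := A - 1 + ((i - 1) % m + 1)) (j' := A - 1 + i)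
        ⟨(i - 1) / m, by lia⟩,
      ← periodic_of_dvd hs (j := B - ((i - 1) % m + 1) + 1) (j' := B - i + 1)
        ⟨-((i - 1) / m), by lia⟩] at this
  rcases Int.even_or_odd' (A + B - 1) with ⟨j, hj | hj⟩
  · have := (key (B - j)).1
    rw [show B - (B - j) = j by ring, show A - 1 + (B - j) = j by lia] at this
    exact letterInv_ne _ this.symm
  · have h1 := (key (B - j - 1)).1
    have h2 := (key (B - j)).2
    rw [show B - (B - j - 1) = j + 1 by ring, show A - 1 + (B - j - 1) = j by lia] at h1
    rw [show B - (B - j) + 1 = j + 1 by ring, show A - 1 + (B - j) = j + 1 by lia] at h2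
    exact hred j (by lia) h1

/-- If the two ends of a maximal path ask for the same edge, a fresh edge prolongs both. -/
theorem IsMaximalPath.exists_prolong
    (hred : ∀ j, (s (j + 1)).1 = 0 → (s (j + 1)).2 ≠ letterInv (s j).2)
    (h : IsMaximalPath E s p A B) (h1 : p B + (s B).1 = p A)
    (h2 : (s B).2 = letterInv (s (A - 1)).2) :
    ∃ E' q, E ⊆ E' ∧ IsMaximalPath E' s q (A - 1) (B + 1) ∧ q 0 = p 0 ∧
      q (A - 1) + (s (A - 1)).1 = q (B + 1) := by
  classical
  have h0 := h.nonneg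
  have h0' := h.nonpos
  obtain ⟨N, hN⟩ := exists_fresh E {p A} {0, (s (B + 1)).1, -(s (A - 1)).1}
  obtain ⟨hN1, hN2⟩ := hN 0 (by simp)
  obtain ⟨hN3, hN4⟩ := hN (s (B + 1)).1 (by simp)
  obtain ⟨hN5, hN6⟩ := hN (-(s (A - 1)).1) (by simp)
  simp only [add_zero, Finset.mem_singleton] at hN1 hN2 hN3 hN5
  have hsub := Finset.subset_insert (letterEdge (s B).2 (p A) N) E
  have h2' : (s (A - 1)).2 = letterInv (s B).2 := by rw [h2, letterInv_letterInv]
  set q := Function.update (Function.update p (B + 1) N) (A - 1) (N - (s (A - 1)).1) with hq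
  have hqA : q (A - 1) = N - (s (A - 1)).1 := by simp [hq]
  have hqB : q (B + 1) = N := by
    rw [hq, Function.update_of_ne (by lia), Function.update_self]
  have hqj : ∀ j, A ≤ j → j ≤ B → q j = p j := by
    intro j _ _
    rw [hq, Function.update_of_ne (by lia), Function.update_of_ne (by lia)]
  refine ⟨insert (letterEdge (s B).2 (p A) N) E, q, hsub,
    ⟨h.inj.insert (h1 ▸ h.fwd) fun u => ?_, by lia, by lia, ?_, ?_, ?_⟩,
    hqj 0 h0' h0, by lia⟩
  · rw [← letterEdge_letterInv]
    exact hN2 _ _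
  · intro j hj1 hj2
    rcases (by lia : j = A - 1 ∨ j = B ∨ (A ≤ j ∧ j < B)) with rfl | rfl | ⟨h3, h4⟩
    · rw [hqA, sub_add_cancel, sub_add_cancel, hqj A le_rfl (by lia), h2',
        letterEdge_letterInv]
      simp
    · rw [hqB, hqj j (by lia) le_rfl, h1]
      simp
    · rw [hqj j h3 h4.le, hqj (j + 1) (by lia) (by lia)]
      exact hsub (h.path j h3 h4)
  · intro v
    rw [hqB, Finset.mem_insert, letterEdge_eq_iff, not_or]
    refine ⟨?_, hN4 _ _⟩
    rintro (⟨_, h3, _⟩ | ⟨h3, h4, _⟩)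
    · exact hN3 h3
    · exact hred B (by lia) h3
  · intro u
    rw [hqA, Finset.mem_insert, letterEdge_eq_iff, not_or]
    refine ⟨?_, ?_⟩
    · rintro (⟨h3, _, h4⟩ | ⟨_, _, h4⟩)
      · refine hred (A - 1 - 1) ?_ ?_
        · rw [sub_add_cancel]
          lia
        · rw [sub_add_cancel, h3, h2']
      · exact hN5 (by lia)
    · rw [← letterEdge_letterInv, sub_eq_add_neg]
      exact hN6 _ _

/-- A finite partial action extends so that the path of a cyclically reduced word closes up. -/
theorem isClosable_of_reduced (hE : IsPartialInj E) (hs : ∀ j, s (j + m) = s j) (hm : 0 < m)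
    (hred : ∀ j, (s (j + 1)).1 = 0 → (s (j + 1)).2 ≠ letterInv (s j).2) (x : ℤ) :
    IsClosable E s m x := by
  by_contra hcon
  have key : ∀ n : ℕ, ∃ E' p A B, E ⊆ E' ∧ IsMaximalPath E' s p A B ∧ p 0 = x ∧
      ∀ i, 1 ≤ i → i ≤ (n : ℤ) → (s (B - i)).2 = letterInv (s (A - 1 + i)).2 ∧
      (s (B - i + 1)).1 = -(s (A - 1 + i)).1 := by
    intro n
    induction n with
    | zero =>
      rcases exists_isMaximalPath (p := fun _ => x) (A := 0) (B := 0) hE hs hm le_rfl le_rfl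
        (fun j h1 h2 => by lia) with h | ⟨q, A, B, h, hq⟩
      · exact absurd h hcon
      · exact ⟨E, q, A, B, subset_rfl, h, hq, fun i h1 h2 => by push_cast at h2; lia⟩
    | succ n ih =>
      obtain ⟨E', p, A, B, hsub, hmax, rfl, hsymm⟩ := ih
      have hcl := fun hne => hcon ((hmax.isClosable hs hm hred hne).mono hsub)
      rw [imp_false, not_not] at hcl
      obtain ⟨E'', q, hsub', hmax', hq0, hq⟩ := hmax.exists_prolong hred hcl.1 hcl.2
      have hcl' := fun hne => hcon
        (hq0 ▸ ((hmax'.isClosable hs hm hred hne).mono (hsub.trans hsub')))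
      rw [imp_false, not_not] at hcl'
      refine ⟨E'', q, A - 1, B + 1, hsub.trans hsub', hmax', hq0, fun i h1 h2 => ?_⟩
      push_cast at h2
      rcases (by lia : i = 1 ∨ 1 ≤ i - 1) with rfl | h3
      · rw [show B + 1 - 1 = B by ring, show A - 1 - 1 + 1 = A - 1 by ring]
        exact ⟨hcl.2, by lia⟩
      · have := hsymm (i - 1) h3 (by lia)
        rwa [show B - (i - 1) = B + 1 - i by ring,
          show A - 1 + (i - 1) = A - 1 - 1 + i by ring] at this
  obtain ⟨_, _, A, B, _, _, _, hsymm⟩ := key m.toNat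
  rw [Int.toNat_of_nonneg hm.le] at hsymm
  exact not_symmetric_of_reduced hs hm hred hsymm

/-- Finite partial injections extend to permutations. -/
theorem IsPartialInj.exists_perm (hE : IsPartialInj E) :
    ∃ β : J → Equiv.Perm ℤ, ∀ i u v, (i, u, v) ∈ E → β i u = v := by
  classical
  induction E using Finset.induction_on with
  | empty => exact ⟨fun _ => 1, by simp⟩
  | insert e E he ih =>
    obtain ⟨i, u, v⟩ := e
    obtain ⟨β, hβ⟩ := ih fun c a b b' h h' =>
      hE c a b b' (Finset.mem_insert_of_mem h) (Finset.mem_insert_of_mem h')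
    refine ⟨Function.update β i (Equiv.swap (β i u) v * β i), fun i' u' v' h => ?_⟩
    rcases Finset.mem_insert.1 h with h' | h'
    · obtain ⟨rfl, rfl, rfl⟩ : i' = i ∧ u' = u ∧ v' = v := by simpa using h'
      simp
    · have hb := hβ _ _ _ h'
      by_cases hi : i' = i
      · subst hi
        have hu : u' ≠ u := by
          rintro rfl
          have := hE (i', true) u' v v' (by simp [letterEdge]) (by simp [letterEdge, h'])
          exact he (this ▸ h')
        have hv : v' ≠ v := by
          rintro rfl
          have := hE (i', false) v' u u' (by simp [letterEdge]) (by simp [letterEdge, h'])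
          exact hu this.symm
        rw [Function.update_self, Equiv.Perm.mul_apply, hb, Equiv.swap_apply_of_ne_of_ne _ hv]
        rw [← hb]
        exact fun h => hu ((β i').injective h)
      · rw [Function.update_of_ne hi]
        exact hb

end PartialActions

section Words

variable {ι : Type*} {a₀ : ι}

/-- The group element `c * a₀ ^ k` of a syllable `(k, c)`. -/
def syllable (a₀ : ι) (t : ℤ × {i // i ≠ a₀} × Bool) : FreeGroup ι :=
  (if t.2.2 then FreeGroup.of t.2.1.1 else (FreeGroup.of t.2.1.1)⁻¹) * FreeGroup.of a₀ ^ t.1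

/-- The product of a list of syllables, the head of the list acting first. -/
def syllableProd (a₀ : ι) : List (ℤ × {i // i ≠ a₀} × Bool) → FreeGroup ι
  | [] => 1
  | t :: l => syllableProd a₀ l * syllable a₀ t

theorem syllableProd_append (l l' : List (ℤ × {i // i ≠ a₀} × Bool)) :
    syllableProd a₀ (l ++ l') = syllableProd a₀ l' * syllableProd a₀ l := by
  induction l with
  | nil => simp [syllableProd]
  | cons t l ih => simp [syllableProd, ih, mul_assoc]

theorem syllable_mul_zpow (k n : ℤ) (c : {i // i ≠ a₀} × Bool) :
    syllable a₀ (k, c) * FreeGroup.of a₀ ^ n = syllable a₀ (k + n, c) := by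
  simp [syllable, mul_assoc, zpow_add]

theorem syllable_letterInv_mul (k : ℤ) (c : {i // i ≠ a₀} × Bool) :
    syllable a₀ (0, letterInv c) * syllable a₀ (k, c) = FreeGroup.of a₀ ^ k := by
  rcases c with ⟨i, _ | _⟩ <;> simp [syllable, letterInv]

theorem exists_eq_zpow_mul_syllableProd (a₀ : ι) (w : FreeGroup ι) :
    ∃ (k : ℤ) (l : List (ℤ × {i // i ≠ a₀} × Bool)),
      w = FreeGroup.of a₀ ^ k * syllableProd a₀ l := by
  classical
  have key : ∀ L : List (ι × Bool), ∃ (k : ℤ) (l : List (ℤ × {i // i ≠ a₀} × Bool)),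
      FreeGroup.mk L = FreeGroup.of a₀ ^ k * syllableProd a₀ l := by
    intro L
    induction L with
    | nil => exact ⟨0, [], by simp [syllableProd, FreeGroup.one_eq_mk]⟩
    | cons e L ih =>
      obtain ⟨k, l, h⟩ := ih
      obtain ⟨i, b⟩ := e
      have he : FreeGroup.mk ((i, b) :: L) =
          (if b then FreeGroup.of i else (FreeGroup.of i)⁻¹) * FreeGroup.mk L := by
        cases b <;> simp [FreeGroup.of, FreeGroup.inv_mk, FreeGroup.invRev, FreeGroup.mul_mk]
      rw [he, h]
      by_cases hi : i = a₀
      · subst hi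
        cases b
        · exact ⟨-1 + k, l, by simp [zpow_add, mul_assoc]⟩
        · exact ⟨1 + k, l, by simp [zpow_add, mul_assoc]⟩
      · exact ⟨0, l ++ [(k, ⟨i, hi⟩, b)],
          by simp [syllableProd_append, syllableProd, syllable, mul_assoc]⟩
  have := key w.toWord
  rwa [FreeGroup.mk_toWord] at this

theorem exists_isConj_syllableProd {w : FreeGroup ι}
    (hw : ∀ k : ℤ, ¬ IsConj w (FreeGroup.of a₀ ^ k)) :
    ∃ l : List (ℤ × {i // i ≠ a₀} × Bool), IsConj w (syllableProd a₀ l) := by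
  obtain ⟨k, l, rfl⟩ := exists_eq_zpow_mul_syllableProd a₀ w
  have hconj : IsConj (FreeGroup.of a₀ ^ k * syllableProd a₀ l)
      (syllableProd a₀ l * FreeGroup.of a₀ ^ k) :=
    isConj_iff.2 ⟨(FreeGroup.of a₀ ^ k)⁻¹, by group⟩
  cases l with
  | nil => exact (hw k (by rw [syllableProd, mul_one])).elim
  | cons t l =>
    refine ⟨(t.1 + k, t.2) :: l, ?_⟩
    rwa [syllableProd, mul_assoc, syllable_mul_zpow] at hconj

theorem isConj_syllableProd_rotate (l : List (ℤ × {i // i ≠ a₀} × Bool)) (n : ℕ) :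
    IsConj (syllableProd a₀ l) (syllableProd a₀ (l.rotate n)) := by
  induction n generalizing l with
  | zero => exact (List.rotate_zero l).symm ▸ IsConj.refl _
  | succ n ih =>
    cases l with
    | nil => exact (List.rotate_nil (n + 1)).symm ▸ IsConj.refl _
    | cons t l =>
      rw [List.rotate_cons_succ]
      refine IsConj.trans ?_ (ih _)
      rw [syllableProd_append]
      exact isConj_iff.2 ⟨syllable a₀ t, by simp [syllableProd, mul_assoc]⟩

/-- A word which is not conjugate to a power of `a₀` is conjugate to a nonempty cyclically reduced
product of syllables. -/
theorem exists_reduced_syllables {w : FreeGroup ι}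
    (hw : ∀ k : ℤ, ¬ IsConj w (FreeGroup.of a₀ ^ k)) :
    ∃ (m : ℕ) (s : ℤ → ℤ × {i // i ≠ a₀} × Bool), 0 < m ∧ (∀ j, s (j + m) = s j) ∧
      (∀ j, (s (j + 1)).1 = 0 → (s (j + 1)).2 ≠ letterInv (s j).2) ∧
      IsConj w (syllableProd a₀ ((List.range m).map fun n : ℕ => s n)) := by
  classical
  have hex : ∃ n, ∃ l : List (ℤ × {i // i ≠ a₀} × Bool),
      l.length = n ∧ IsConj w (syllableProd a₀ l) := by
    obtain ⟨l, hl⟩ := exists_isConj_syllableProd hw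
    exact ⟨_, l, rfl, hl⟩
  obtain ⟨l, hlen, hl⟩ := Nat.find_spec hex
  have hmin : ∀ l' : List (ℤ × {i // i ≠ a₀} × Bool), l'.length < l.length →
      ¬ IsConj w (syllableProd a₀ l') := fun l' h h' =>
    Nat.find_min hex (hlen ▸ h) ⟨l', rfl, h'⟩
  clear hlen
  have hpos : 0 < l.length := by
    rw [List.length_pos_iff]
    rintro rfl
    exact hw 0 (by simpa [syllableProd] using hl)
  have hlt : ∀ j : ℤ, (j % l.length).toNat < l.length := fun j => by
    have := Int.emod_lt_of_pos j (b := l.length) (by lia)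
    lia
  refine ⟨l.length, fun j => l[(j % l.length).toNat]'(hlt j), hpos, by simp, ?_, ?_⟩
  · intro j h1 h2
    set r := (j % l.length).toNat with hr
    have hrot : ∀ l', l.rotate r = l' → IsConj w (syllableProd a₀ l') := by
      rintro _ rfl
      exact hl.trans (isConj_syllableProd_rotate l r)
    have hlenrot : (l.rotate r).length = l.length := List.length_rotate ..
    have hget0 : ∀ h, (l.rotate r)[0]'h = l[r]'(hlt j) := by
      intro h
      rw [List.getElem_rotate]
      congr 1
      rw [zero_add, Nat.mod_eq_of_lt (hlt j)]
    have hget1 : ∀ h, (l.rotate r)[1]'h = l[((j + 1) % l.length).toNat]'(hlt (j + 1)) := by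
      intro h
      rw [List.getElem_rotate]
      congr 1
      zify
      rw [hr, Int.toNat_of_nonneg (Int.emod_nonneg _ (by lia)),
        Int.toNat_of_nonneg (Int.emod_nonneg _ (by lia))]
      simp [add_comm]
    match hrl : l.rotate r with
    | [] => simp [hrl] at hlenrot; lia
    | [t] =>
      have h3 : l.length = 1 := by simpa [hrl] using hlenrot.symm
      have h4 : ((j + 1) % l.length).toNat = r := by
        rw [hr, h3]
        simp
      simp only [h4] at h2
      exact letterInv_ne _ h2.symm
    | (k, c) :: (k', c') :: l' =>
      simp only [hrl] at hget0 hget1 hlenrot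
      have h3 := hget0 (by simp)
      have h4 := hget1 (by simp)
      simp only [List.getElem_cons_zero, List.getElem_cons_succ] at h3 h4
      change (l[((j + 1) % l.length).toNat]'(hlt (j + 1))).2 = letterInv (l[r]'(hlt j)).2 at h2
      simp only [← h3, ← h4] at h1 h2
      subst h1 h2
      have hc := hrot _ hrl
      rw [syllableProd, syllableProd, mul_assoc, syllable_letterInv_mul] at hc
      cases l' with
      | nil => exact hw k (by simpa [syllableProd] using hc)
      | cons t l' =>
        rw [syllableProd, mul_assoc, syllable_mul_zpow] at hc
        refine hmin ((t.1 + k, t.2) :: l') ?_ hc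
        simp at hlenrot ⊢
        lia
  · convert hl using 2
    apply List.ext_getElem
    · simp
    · intro n h1 h2
      have : (((n : ℤ) % l.length).toNat) = n := by
        rw [← Int.natCast_mod, Nat.mod_eq_of_lt h2]
        simp
      simp [this]

end Words

section Generic

variable {ι : Type*} {a₀ : ι}

/-- The value of a homomorphism at a group element and a point only depends on finitely many
edges. -/
theorem exists_finset_edges (ρ₀ : HomSigma a₀) (g : FreeGroup ι) :
    ∀ n : ℤ, ∃ E : Finset ({i // i ≠ a₀} × ℤ × ℤ),
      (∀ i u v, (i, u, v) ∈ E → ρ₀.1 (FreeGroup.of i.1) u = v) ∧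
      ∀ ρ : HomSigma a₀, (∀ i u v, (i, u, v) ∈ E → ρ.1 (FreeGroup.of i.1) u = v) →
        ρ.1 g n = ρ₀.1 g n := by
  classical
  induction g using FreeGroup.induction_on with
  | C1 => exact fun n => ⟨∅, by simp, by simp⟩
  | of i =>
    intro n
    by_cases hi : i = a₀
    · subst hi
      exact ⟨∅, by simp, fun ρ _ => by rw [ρ.2, ρ₀.2]⟩
    · exact ⟨{(⟨i, hi⟩, n, ρ₀.1 (FreeGroup.of i) n)},
        by simp +contextual, fun ρ h =>
        h ⟨i, hi⟩ _ _ (Finset.mem_singleton_self _)⟩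
  | inv_of i _ =>
    intro n
    by_cases hi : i = a₀
    · subst hi
      exact ⟨∅, by simp, fun ρ _ => by rw [map_inv, map_inv, ρ.2, ρ₀.2]⟩
    · refine ⟨{(⟨i, hi⟩, (ρ₀.1 (FreeGroup.of i))⁻¹ n, n)}, by simp +contextual, fun ρ h => ?_⟩
      rw [map_inv, map_inv, Equiv.Perm.inv_eq_iff_eq]
      exact (h ⟨i, hi⟩ _ _ (Finset.mem_singleton_self _)).symm
  | mul g h ihg ihh =>
    intro n
    obtain ⟨E, hE, hE'⟩ := ihh n
    obtain ⟨F, hF, hF'⟩ := ihg (ρ₀.1 h n)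
    refine ⟨E ∪ F, fun i u v huv => ?_, fun ρ hρ => ?_⟩
    · exact (Finset.mem_union.1 huv).elim (hE i u v) (hF i u v)
    · rw [map_mul, map_mul, Equiv.Perm.mul_apply, Equiv.Perm.mul_apply,
        hE' ρ fun i u v huv => hρ i u v (Finset.mem_union_left _ huv),
        hF' ρ fun i u v huv => hρ i u v (Finset.mem_union_right _ huv)]

theorem continuous_homSigma_apply (g : FreeGroup ι) (x : ℤ) :
    Continuous fun ρ : HomSigma a₀ => ρ.1 g x := by
  have h1 : Continuous fun ρ : HomSigma a₀ => (ρ.1 : FreeGroup ι → Equiv.Perm ℤ) :=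
    continuous_induced_dom.comp continuous_subtype_val
  have h2 : Continuous fun f : Equiv.Perm ℤ => (f : ℤ → ℤ) := continuous_induced_dom
  exact (continuous_apply x).comp (h2.comp ((continuous_apply g).comp h1))

theorem nhds_homSigma (ρ₀ : HomSigma a₀) :
    nhds ρ₀ = ⨅ a : FreeGroup ι × ℤ, Filter.principal {ρ : HomSigma a₀ | ρ.1 a.1 a.2 = ρ₀.1 a.1 a.2} := by
  simp only [nhds_induced, nhds_pi, Filter.pi, nhds_discrete, comap_iInf,
    comap_pure, comap_principal, iInf_prod]
  rfl

/-- Basic neighbourhoods are given by finitely many edges. -/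
theorem exists_finset_edges_of_mem_nhds {ρ₀ : HomSigma a₀} {U : Set (HomSigma a₀)}
    (hU : U ∈ nhds ρ₀) :
    ∃ E : Finset ({i // i ≠ a₀} × ℤ × ℤ),
      (∀ i u v, (i, u, v) ∈ E → ρ₀.1 (FreeGroup.of i.1) u = v) ∧
      ∀ ρ : HomSigma a₀, (∀ i u v, (i, u, v) ∈ E → ρ.1 (FreeGroup.of i.1) u = v) → ρ ∈ U := by
  classical
  rw [nhds_homSigma] at hU
  obtain ⟨t, ht, htU⟩ := (Filter.hasBasis_iInf_principal_finite _).mem_iff.1 hU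
  choose E hE hE' using fun a : FreeGroup ι × ℤ => exists_finset_edges ρ₀ a.1 a.2
  refine ⟨ht.toFinset.biUnion E, fun i u v h => ?_, fun ρ h => htU ?_⟩
  · obtain ⟨a, _, ha⟩ := Finset.mem_biUnion.1 h
    exact hE a i u v ha
  · refine mem_iInter₂.2 fun a ha => hE' a ρ fun i u v huv => h i u v ?_
    exact Finset.mem_biUnion.2 ⟨a, ht.mem_toFinset.2 ha, huv⟩

theorem isPartialInj_of_perm {J : Type*} {E : Finset (J × ℤ × ℤ)} {β : J → Equiv.Perm ℤ}
    (h : ∀ i u v, (i, u, v) ∈ E → β i u = v) : IsPartialInj E := by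
  rintro ⟨i, _ | _⟩ u v v' h1 h2
  · exact (β i).injective ((h _ _ _ h1).trans (h _ _ _ h2).symm)
  · exact (h _ _ _ h1).symm.trans (h _ _ _ h2)

/-- Every finite partial action extends to a homomorphism for which a given point has a finite
orbit under a given word not conjugate to a power of `a₀`. -/
theorem exists_homSigma_periodic {w : FreeGroup ι}
    (hw : ∀ k : ℤ, ¬ IsConj w (FreeGroup.of a₀ ^ k)) {E : Finset ({i // i ≠ a₀} × ℤ × ℤ)}
    {ρ₀ : HomSigma a₀} (hE : ∀ i u v, (i, u, v) ∈ E → ρ₀.1 (FreeGroup.of i.1) u = v) (x : ℤ) :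
    ∃ ρ : HomSigma a₀, (∀ i u v, (i, u, v) ∈ E → ρ.1 (FreeGroup.of i.1) u = v) ∧
      ∃ n : ℕ, 0 < n ∧ ρ.1 (w ^ n) x = x := by
  classical
  obtain ⟨m, s, hm, hs, hred, hconj⟩ := exists_reduced_syllables hw
  obtain ⟨g, hg⟩ := isConj_iff.1 hconj
  obtain ⟨F, hF, hF'⟩ := exists_finset_edges ρ₀ g x
  obtain ⟨E', hsub, hE', q, T, hT, hmT, hq, hq0, hqT⟩ := isClosable_of_reduced (E := E ∪ F)
    (isPartialInj_of_perm (β := fun i => ρ₀.1 (FreeGroup.of i.1)) fun i u v h =>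
      (Finset.mem_union.1 h).elim (hE i u v) (hF i u v)) hs (by exact_mod_cast hm) hred
    (ρ₀.1 g x)
  obtain ⟨β, hβ⟩ := hE'.exists_perm
  let ρ : HomSigma a₀ := ⟨FreeGroup.lift fun i => if h : i = a₀ then shiftPerm else β ⟨i, h⟩,
    by simp⟩
  have hρ : ∀ i u v, (i, u, v) ∈ E' → ρ.1 (FreeGroup.of i.1) u = v := by
    intro i u v h
    simp only [ρ, FreeGroup.lift_apply_of, dif_neg i.2]
    exact hβ _ _ _ h
  have hgx : ρ.1 g x = ρ₀.1 g x :=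
    hF' ρ fun i u v h => hρ i u v (hsub (Finset.mem_union_right _ h))
  have hshift : ∀ k n : ℤ, (shiftPerm ^ k) n = n + k := by
    intro k n
    simp [shiftPerm]
  have hsyl : ∀ j, ρ.1 (syllable a₀ (s j)) (q j) = q (j + 1) := by
    intro j
    have := hq j
    rw [syllable, map_mul, map_zpow, ρ.2, Equiv.Perm.mul_apply, hshift]
    unfold letterEdge at this
    split_ifs at this ⊢ with hb
    · exact hρ _ _ _ this
    · rw [map_inv, Equiv.Perm.inv_eq_iff_eq]
      exact (hρ _ _ _ this).symm
  have hprod : ∀ (N : ℤ) (t : ℕ),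
      ρ.1 (syllableProd a₀ ((List.range t).map fun n : ℕ => s n)) (q (m * N)) =
        q (m * N + t) := by
    intro N t
    induction t with
    | zero => simp [syllableProd]
    | succ t ih =>
      have hst : s t = s (m * N + t) :=
        (periodic_of_dvd hs (by simp)).symm
      rw [List.range_succ, List.map_append, syllableProd_append, map_mul,
        Equiv.Perm.mul_apply, ih]
      simp only [List.map_cons, List.map_nil, syllableProd, one_mul]
      rw [hst, hsyl]
      push_cast
      ring_nf
  have hpow : ∀ n : ℕ, ρ.1 ((g * w * g⁻¹) ^ n) (q 0) = q (m * n) := by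
    intro n
    induction n with
    | zero => simp
    | succ n ih =>
      rw [pow_succ', map_mul, Equiv.Perm.mul_apply, ih, hg, hprod]
      push_cast
      ring_nf
  refine ⟨ρ, fun i u v h => hρ i u v (hsub (Finset.mem_union_left _ h)), ?_⟩
  obtain ⟨n, rfl⟩ := hmT
  have hn : 0 < n := pos_of_mul_pos_right hT (by positivity)
  lift n to ℕ using hn.le
  refine ⟨n, by exact_mod_cast hn, (ρ.1 g).injective ?_⟩
  have := hpow n
  rw [hq0, hqT, ← hgx, conj_pow] at this
  simpa using this

theorem eventually_residual_periodic (w : FreeGroup ι)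
    (hw : ∀ k : ℤ, ¬ IsConj w (FreeGroup.of a₀ ^ k)) (x : ℤ) :
    ∀ᶠ ρ : HomSigma a₀ in residual (HomSigma a₀), ∃ n : ℕ, 0 < n ∧ ρ.1 (w ^ n) x = x := by
  refine residual_of_dense_open ?_ ?_
  · have : {ρ : HomSigma a₀ | ∃ n : ℕ, 0 < n ∧ ρ.1 (w ^ n) x = x} =
        ⋃ n : ℕ, ⋃ _ : 0 < n, (fun ρ : HomSigma a₀ => ρ.1 (w ^ n) x) ⁻¹' {x} := by
      ext
      simp
    rw [this]
    exact isOpen_iUnion fun n => isOpen_iUnion fun _ =>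
      (isOpen_discrete _).preimage (continuous_homSigma_apply _ _)
  · intro ρ₀
    rw [mem_closure_iff_nhds]
    intro U hU
    obtain ⟨E, hE, hEU⟩ := exists_finset_edges_of_mem_nhds hU
    obtain ⟨ρ, hρ, hn⟩ := exists_homSigma_periodic hw hE x
    exact ⟨ρ, hEU ρ hρ, hn⟩

theorem zOrbit_finite_of_pow_apply_eq {X : Type*} {g : Equiv.Perm X} {x : X} {n : ℕ}
    (hn : 0 < n) (h : (g ^ n) x = x) : (zOrbit g x).Finite := by
  refine ((Set.finite_Ico (0 : ℤ) n).image fun k : ℤ => (g ^ k) x).subset ?_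
  rintro _ ⟨k, rfl⟩
  have hn' : (0 : ℤ) < n := by exact_mod_cast hn
  refine ⟨k % n, ⟨Int.emod_nonneg _ hn'.ne', Int.emod_lt_of_pos _ hn'⟩, ?_⟩
  have h2 : ((g ^ n) ^ (k / n)) x = x := Equiv.Perm.zpow_apply_eq_self_of_apply_eq_self h _
  have h3 : g ^ k = g ^ (k % n) * (g ^ n) ^ (k / n) := by
    rw [← zpow_natCast, ← zpow_mul, ← zpow_add, Int.emod_add_mul_ediv]
  simp only [h3, Equiv.Perm.mul_apply, h2]

theorem zOrbit_conj_zpow_infinite (ρ : HomSigma a₀) (u : FreeGroup ι) {k : ℤ} (hk : k ≠ 0) :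
    ¬ (zOrbit (ρ.1 (u * FreeGroup.of a₀ ^ k * u⁻¹)) (ρ.1 u 0)).Finite := by
  refine Set.infinite_range_of_injective fun n n' h => ?_
  have key : ∀ n : ℤ, (ρ.1 (u * FreeGroup.of a₀ ^ k * u⁻¹) ^ n) (ρ.1 u 0) =
      ρ.1 u (k * n) := by
    intro n
    rw [← map_zpow, conj_zpow, ← zpow_mul]
    simp [ρ.2, shiftPerm]
  simp only [key] at h
  exact mul_left_cancel₀ hk ((ρ.1 u).injective h)

end Generic

/-- **Finite orbits for generic constrained representations.**  For a generic
`ρ ∈ Hom_σ(Γ, Sym(ℤ))` (`Γ` free with basis `(a₀, b₁, b₂, …)`) the following holds: for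
every `w ∈ Γ`, all orbits of `ρ(w)` on `ℤ` are finite if and only if `w` is not of the form
`u a₀^k u⁻¹` with `k ≠ 0`. -/
theorem generic_finite_orbits {ι : Type*} [Countable ι] [Nontrivial ι] (a₀ : ι) :
    {ρ : HomSigma a₀ | ∀ w : FreeGroup ι,
        (∀ x : ℤ, (zOrbit (ρ.1 w) x).Finite) ↔
          ¬ ∃ (u : FreeGroup ι) (k : ℤ), k ≠ 0 ∧ w = u * FreeGroup.of a₀ ^ k * u⁻¹}
      ∈ residual (HomSigma a₀) := by
  have hcount : Countable (FreeGroup ι) := by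
    classical
    exact (FreeGroup.toWord_injective (α := ι)).countable
  have key : ∀ᶠ ρ : HomSigma a₀ in residual (HomSigma a₀), ∀ (w : FreeGroup ι) (x : ℤ),
      (∀ k : ℤ, ¬ IsConj w (FreeGroup.of a₀ ^ k)) → ∃ n : ℕ, 0 < n ∧ ρ.1 (w ^ n) x = x := by
    simp only [eventually_countable_forall]
    exact fun w x hw => eventually_residual_periodic w hw x
  filter_upwards [key] with ρ hρ
  intro w
  constructor
  · rintro hfin ⟨u, k, hk, rfl⟩
    exact zOrbit_conj_zpow_infinite ρ u hk (hfin _)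
  · intro hw x
    by_cases h1 : w = 1
    · exact zOrbit_finite_of_pow_apply_eq one_pos (by simp [h1])
    · obtain ⟨n, hn, hnx⟩ := hρ w x fun k hk => by
        obtain ⟨c, hc⟩ := isConj_iff.1 hk
        refine hw ⟨c⁻¹, k, ?_, by rw [← hc]; group⟩
        rintro rfl
        rw [zpow_zero, conj_eq_one_iff] at hc
        exact h1 hc
      exact zOrbit_finite_of_pow_apply_eq hn (by rwa [← map_pow])
end

section
/- For a generic ρ ∈ Hom_σ(Γ, Sym(ℤ)), the stabilizer map ℤ → Sub(Γ), x ↦ Stab_Γ(x) = {γ ∈ Γ : ρ(γ)(x) = x}, is injective. -/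
open Filter Set

/-- The stabilizer `Stab_Γ(x) = {γ ∈ Γ : ρ(γ)(x) = x}` as a subgroup of `Γ`. -/
noncomputable def stabSubgroup {ι : Type*} (ρ : FreeGroup ι →* Equiv.Perm ℤ) (x : ℤ) :
    Subgroup (FreeGroup ι) :=
  (MulAction.stabilizer (Equiv.Perm ℤ) x).comap ρ

/-- Evaluation of a representation at a group element and a point is continuous. -/
theorem continuous_homSigma_eval {ι : Type*} {a₀ : ι} (γ : FreeGroup ι) (z : ℤ) :
    Continuous fun ρ : HomSigma a₀ => ρ.1 γ z := by
  have h1 : Continuous fun g : Equiv.Perm ℤ => (g : ℤ → ℤ) := continuous_induced_dom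
  have h2 : Continuous fun ρ : FreeGroup ι →* Equiv.Perm ℤ =>
      (ρ : FreeGroup ι → Equiv.Perm ℤ) := continuous_induced_dom
  exact (continuous_apply z).comp
    (h1.comp ((continuous_apply γ).comp (h2.comp continuous_subtype_val)))

/-- Eventual pointwise agreement implies convergence of representations. -/
theorem tendsto_homSigma_of_eventually_eq {ι α : Type*} {a₀ : ι} {l : Filter α}
    {u : α → HomSigma a₀} {ρ : HomSigma a₀}
    (h : ∀ γ z, ∀ᶠ n in l, (u n).1 γ z = ρ.1 γ z) : Tendsto u l (nhds ρ) := by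
  rw [tendsto_subtype_rng, nhds_induced, tendsto_comap_iff, tendsto_pi_nhds]
  intro γ
  rw [nhds_induced, tendsto_comap_iff, tendsto_pi_nhds]
  intro z
  rw [nhds_discrete, tendsto_pure]
  exact h γ z

/-- Homomorphisms which eventually agree pointwise on the free generators eventually agree
pointwise on the whole free group. -/
theorem eventually_eq_of_eventually_eq_generators {ι α β : Type*} {l : Filter α}
    {u : α → FreeGroup ι →* Equiv.Perm β} {ρ : FreeGroup ι →* Equiv.Perm β}
    (h : ∀ i z, ∀ᶠ n in l, u n (FreeGroup.of i) z = ρ (FreeGroup.of i) z)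
    (γ : FreeGroup ι) : ∀ z, ∀ᶠ n in l, u n γ z = ρ γ z := by
  induction γ using FreeGroup.induction_on with
  | C1 => simp
  | of i => exact h i
  | inv_of i hi =>
    intro z
    filter_upwards [hi ((ρ (FreeGroup.of i))⁻¹ z)] with n hn
    rw [map_inv, map_inv, Equiv.Perm.inv_eq_iff_eq, hn]
    simp
  | mul γ δ hγ hδ =>
    intro z
    filter_upwards [hγ (ρ δ z), hδ z] with n h1 h2
    rw [map_mul, map_mul, Equiv.Perm.mul_apply, Equiv.Perm.mul_apply, h2, h1]

/-- Every permutation agrees on `(-∞, n]` with a permutation `g'` for which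
`x + m ↦ x + k` but `y + m` is not sent to `y + k`, for some `m` and `k`. -/
theorem exists_perm_separating (g : Equiv.Perm ℤ) {x y : ℤ} (hxy : x ≠ y) (n : ℤ) :
    ∃ g' : Equiv.Perm ℤ, (∀ z ≤ n, g' z = g z) ∧
      ∃ m k : ℤ, g' (x + m) = x + k ∧ g' (y + m) ≠ y + k := by
  obtain ⟨m, hm⟩ : ∃ m, m = |n| + |x| + |y| + 1 := ⟨_, rfl⟩
  obtain ⟨k, hk⟩ : ∃ k, k = g (x + m) - x := ⟨_, rfl⟩
  by_cases hy : g (y + m) = y + k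
  · obtain ⟨w, hw⟩ : ∃ w, w = m + |x| + |y| + 1 := ⟨_, rfl⟩
    refine ⟨g * Equiv.swap (y + m) w, fun z hz => ?_, m, k, ?_, ?_⟩
    · rw [Equiv.Perm.mul_apply, Equiv.swap_apply_of_ne_of_ne] <;> grind
    · rw [Equiv.Perm.mul_apply, Equiv.swap_apply_of_ne_of_ne] <;> grind
    · rw [Equiv.Perm.mul_apply, Equiv.swap_apply_left, ← hy, Ne, g.injective.eq_iff]
      grind
  · exact ⟨g, fun _ _ => rfl, m, k, by grind, hy⟩

theorem shiftPerm_zpow_apply (k z : ℤ) : (shiftPerm ^ k) z = z + k := by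
  simp [shiftPerm]

/-- Representations for which some element fixes `x` but not `y` are dense. -/
theorem dense_exists_fix_not_fix {ι : Type*} [Nontrivial ι] (a₀ : ι) {x y : ℤ} (hxy : x ≠ y) :
    Dense {ρ : HomSigma a₀ | ∃ γ, ρ.1 γ x = x ∧ ρ.1 γ y ≠ y} := by
  classical
  intro ρ
  obtain ⟨b, hb⟩ := exists_ne a₀
  choose g hg m k hx hy using
    fun n : ℕ => exists_perm_separating (ρ.1 (FreeGroup.of b)) hxy n
  let f (n : ℕ) : ι → Equiv.Perm ℤ :=
    Function.update (fun i => ρ.1 (FreeGroup.of i)) b (g n)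
  have hfa (n : ℕ) : FreeGroup.lift (f n) (FreeGroup.of a₀) = shiftPerm := by
    simp [f, hb.symm, ρ.2]
  have hfb (n : ℕ) : FreeGroup.lift (f n) (FreeGroup.of b) = g n := by simp [f]
  refine mem_closure_of_tendsto (f := fun n : ℕ => (⟨FreeGroup.lift (f n), hfa n⟩ : HomSigma a₀))
    (b := atTop) (tendsto_homSigma_of_eventually_eq
      (eventually_eq_of_eventually_eq_generators fun i z => ?_)) (Eventually.of_forall fun n => ?_)
  · by_cases hi : i = b
    · subst hi
      filter_upwards [eventually_ge_atTop z.toNat] with n hn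
      rw [hfb, hg n z (by omega)]
    · simp [f, hi]
  · refine ⟨FreeGroup.of a₀ ^ (-k n) * FreeGroup.of b * FreeGroup.of a₀ ^ m n, ?_, ?_⟩
    · simp only [map_mul, map_zpow, hfa, hfb, Equiv.Perm.mul_apply, shiftPerm_zpow_apply, hx]
      ring
    · simp only [map_mul, map_zpow, hfa, hfb, Equiv.Perm.mul_apply, shiftPerm_zpow_apply]
      have := hy n
      omega

/-- The condition that some element fixes `x` but not `y` is open. -/
theorem isOpen_exists_fix_not_fix {ι : Type*} (a₀ : ι) (x y : ℤ) :
    IsOpen {ρ : HomSigma a₀ | ∃ γ, ρ.1 γ x = x ∧ ρ.1 γ y ≠ y} := by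
  rw [ofPred_exists]
  exact isOpen_iUnion fun γ =>
    ((isOpen_discrete {x}).preimage (continuous_homSigma_eval γ x)).inter
      ((isOpen_discrete {y}ᶜ).preimage (continuous_homSigma_eval γ y))

/-- **Injectivity of the stabilizer map for generic constrained representations.**  For a
generic `ρ ∈ Hom_σ(Γ, Sym(ℤ))` (`Γ` free with basis `(a₀, b₁, b₂, …)`), the stabilizer map
`ℤ → Sub(Γ)`, `x ↦ Stab_Γ(x)` is injective. -/
theorem generic_stabilizer_injective {ι : Type*} [Countable ι] [Nontrivial ι] (a₀ : ι) :
    {ρ : HomSigma a₀ | Function.Injective fun x : ℤ => stabSubgroup ρ.1 x}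
      ∈ residual (HomSigma a₀) := by
  have h : ∀ᶠ ρ in residual (HomSigma a₀), ∀ x y : ℤ, x ≠ y →
      ∃ γ, ρ.1 γ x = x ∧ ρ.1 γ y ≠ y := by
    simp only [eventually_countable_forall]
    intro x y hxy
    exact residual_of_dense_open (isOpen_exists_fix_not_fix a₀ x y)
      (dense_exists_fix_not_fix a₀ hxy)
  filter_upwards [h] with ρ hρ x y hxy
  by_contra hne
  obtain ⟨γ, hγx, hγy⟩ := hρ x y hne
  have hmem : γ ∈ stabSubgroup ρ.1 x := hγx
  exact hγy ((SetLike.ext_iff.mp hxy γ).mp hmem)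
end
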